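/- Let φ be a locally Hölder potential on X = [0,1]∖ℚ with φ ≤ 0, P(φ) = 0 and 𝓛_φ1 = 1, let μ_φ be its Gibbs measure, and let f be a locally Hölder observable. If there exists t₀ > 0 such that (−t₀, t₀) ⊂ {t ∈ ℝ : P(tf + φ) < ∞}, then for every α ≠ ∫ f dμ_φ there exists t ∈ (−t₀, t₀) with P(t(f − α) + φ) < 0. -/

import Mathlib

open MeasureTheory Filter Set Topology
open scoped ENNReal NNReal Classical Real

noncomputable section

/-- The Gauss map `T(x) = 1/x mod 1`. -/
def gaussMap (x : ℝ) : ℝ := Int.fract x⁻¹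

/-- The space `X = [0,1] ∖ ℚ` of irrational numbers in the unit interval. -/
def gaussSet : Set ℝ := {x | x ∈ Set.Icc (0:ℝ) 1 ∧ Irrational x}

/-- The first continued fraction digit `a₁(x) = ⌊1/x⌋`. -/
def cfDigit1 (x : ℝ) : ℕ := ⌊x⁻¹⌋₊

/-- The `(i+1)`-th continued fraction digit `a_{i+1}(x) = a₁(Tⁱ x)`. -/
def cfDigit (i : ℕ) (x : ℝ) : ℕ := cfDigit1 (gaussMap^[i] x)

/-- The inverse branch `T_a(x) = 1/(x+a)` of the Gauss map. -/
def invBranch1 (a : ℕ) (x : ℝ) : ℝ := (x + (a : ℝ))⁻¹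

/-- The composed inverse branch `T_𝐚 = T_{a₁} ∘ ⋯ ∘ T_{aₙ}` for `𝐚 = [a₁,…,aₙ]`. -/
def invBranch (l : List ℕ) (x : ℝ) : ℝ := l.foldr invBranch1 x

/-- The cylinder set `I_𝐚` of points of `X` whose first digits are given by `𝐚`. -/
def cylinder (l : List ℕ) : Set ℝ :=
  {x | x ∈ gaussSet ∧ ∀ i : Fin l.length, cfDigit i.1 x = l.get i}

/-- The Birkhoff sum `S_n φ = ∑_{k<n} φ ∘ T^k`. -/
def birkhoff (φ : ℝ → ℝ) (n : ℕ) (x : ℝ) : ℝ :=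
  ∑ k ∈ Finset.range n, φ (gaussMap^[k] x)

/-- The pair `(pₙ(𝐚), qₙ(𝐚))` of numerator and denominator (continuant) of the
finite continued fraction `[a₁,…,aₙ] = pₙ/qₙ`. -/
def contPQ : List ℕ → ℕ × ℕ
  | [] => (0, 1)
  | a :: l => ((contPQ l).2, a * (contPQ l).2 + (contPQ l).1)

/-- The continuant `qₙ(𝐚)`, the denominator of `[a₁,…,aₙ]` in lowest terms. -/
def contQ (l : List ℕ) : ℕ := (contPQ l).2

/-- Words of length `n` with digits in `ℕ = {1,2,…}`. -/
def Word (n : ℕ) : Type := {l : List ℕ // l.length = n ∧ ∀ a ∈ l, 0 < a}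

/-- The periodic point `𝐚^∞` with periodic continued fraction expansion repeating `𝐚`. -/
def periodicPoint (l : List ℕ) : ℝ :=
  limUnder atTop fun k : ℕ => invBranch (List.flatten (List.replicate k l)) (1/2 : ℝ)

/-- The `n`-th partition sum `∑_{𝐚 ∈ ℕⁿ} exp(S_nφ(𝐚^∞))` appearing in the pressure. -/
def partSum (φ : ℝ → ℝ) (n : ℕ) : ℝ≥0∞ :=
  ∑' l : Word n, ENNReal.ofReal (Real.exp (birkhoff φ n (periodicPoint l.1)))

/-- `φ` has (finite) pressure `P(φ) = p`, i.e. `(1/n) log ∑_{𝐚∈ℕⁿ} exp(S_nφ(𝐚^∞)) → p`. -/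
def HasPressure (φ : ℝ → ℝ) (p : ℝ) : Prop :=
  (∀ n : ℕ, 0 < n → partSum φ n ≠ ⊤) ∧
    Tendsto (fun n : ℕ => Real.log (partSum φ n).toReal / (n : ℝ)) atTop (𝓝 p)

/-- The pressure of `φ` is finite: `P(φ) < ∞`. -/
def PressureFinite (φ : ℝ → ℝ) : Prop := ∃ p : ℝ, HasPressure φ p

/-- `φ` is locally Hölder: oscillation on `n`-cylinders decays geometrically. -/
def LocHolder (φ : ℝ → ℝ) : Prop :=
  ∃ C > (0:ℝ), ∃ θ ∈ Set.Ioo (0:ℝ) 1, ∀ l : List ℕ, l ≠ [] → (∀ a ∈ l, 0 < a) →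
    ∀ x ∈ cylinder l, ∀ y ∈ cylinder l, |φ x - φ y| ≤ C * θ ^ l.length

/-- The normalization `𝓛_φ 1 = 1` of the Ruelle transfer operator of `φ`. -/
def TransferNormalized (φ : ℝ → ℝ) : Prop :=
  ∀ x ∈ gaussSet, ∑' a : ℕ+, Real.exp (φ (invBranch1 (a : ℕ) x)) = 1

/-- `μ` is invariant under the Gauss map. -/
def GaussInvariant (μ : Measure ℝ) : Prop :=
  ∀ s : Set ℝ, MeasurableSet s → μ (gaussMap ⁻¹' s) = μ s

/-- The Gibbs property for the potential `φ` (with `P(φ) = 0`):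
`C⁻¹ e^{S_nφ(T_𝐚 x)} ≤ μ(I_𝐚) ≤ C e^{S_nφ(T_𝐚 x)}`. -/
def IsGibbs (φ : ℝ → ℝ) (μ : Measure ℝ) : Prop :=
  ∃ C : ℝ, 1 ≤ C ∧ ∀ l : List ℕ, l ≠ [] → (∀ a ∈ l, 0 < a) → ∀ x ∈ gaussSet,
    C⁻¹ * Real.exp (birkhoff φ l.length (invBranch l x)) ≤ (μ (cylinder l)).toReal ∧
      (μ (cylinder l)).toReal ≤ C * Real.exp (birkhoff φ l.length (invBranch l x))

/-- The Kolmogorov–Sinai entropy of `μ`: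
`h = lim (1/n) ∑_{𝐚∈ℕⁿ} -μ(I_𝐚) log μ(I_𝐚)`. -/
def HasEntropy (μ : Measure ℝ) (h : ℝ) : Prop :=
  Tendsto (fun n : ℕ => (∑' l : Word n, Real.negMulLog (μ (cylinder l.1)).toReal) / (n : ℝ))
    atTop (𝓝 h)

/-- `log |T'| (x) = log (1/x²)` for the Gauss map. -/
def logAbsDerivGauss (x : ℝ) : ℝ := Real.log (1 / x ^ 2)

/-- The observable `ψ = -log |T'|`. -/
def gaussPsi (x : ℝ) : ℝ := -Real.log (1 / x ^ 2)

/-- The Lyapunov exponent `λ_μ = ∫ log|T'| dμ`. -/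
def lyapunov (μ : Measure ℝ) : ℝ := ∫ x, logAbsDerivGauss x ∂μ

/-- The polynomial tail condition `μ({x : a₁(x) ≥ n}) = O(n^{-δ})`. -/
def PolyTail (μ : Measure ℝ) : Prop :=
  ∃ δ > (0:ℝ), ∃ K : ℝ, ∀ n : ℕ, 0 < n →
    (μ {x | x ∈ gaussSet ∧ n ≤ cfDigit1 x}).toReal ≤ K * (n : ℝ) ^ (-δ)

/-- The Fourier transform `μ̂(ξ) = ∫ e^{-2πiξx} dμ(x)`. -/
def muFourier (μ : Measure ℝ) (ξ : ℝ) : ℂ :=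
  ∫ x, Complex.exp (-(2 * Real.pi * ξ * x : ℝ) * Complex.I) ∂μ

/-- A sequence `u` equidistributes modulo 1. -/
def EquidistributedMod1 (u : ℕ → ℝ) : Prop :=
  ∀ a b : ℝ, 0 ≤ a → a ≤ b → b ≤ 1 →
    Tendsto (fun N : ℕ =>
        (((Finset.range N).filter fun k => Int.fract (u k) ∈ Set.Ico a b).card : ℝ) / (N : ℝ))
      atTop (𝓝 (b - a))

/-- The set `B(𝒜)` of `𝒜`-badly approximable numbers: all digits lie in `𝒜`. -/
def badSet (A : Finset ℕ) : Set ℝ := {x | x ∈ gaussSet ∧ ∀ i : ℕ, cfDigit i x ∈ A}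

/-- Locally Hölder on the subsystem `B(𝒜)`. -/
def LocHolderOn (A : Finset ℕ) (φ : ℝ → ℝ) : Prop :=
  ∃ C > (0:ℝ), ∃ θ ∈ Set.Ioo (0:ℝ) 1, ∀ l : List ℕ, l ≠ [] → (∀ a ∈ l, a ∈ A) →
    ∀ x ∈ cylinder l ∩ badSet A, ∀ y ∈ cylinder l ∩ badSet A,
      |φ x - φ y| ≤ C * θ ^ l.length

/-- The Gibbs property for the Gauss map restricted to `B(𝒜)`. -/
def IsGibbsOn (A : Finset ℕ) (φ : ℝ → ℝ) (μ : Measure ℝ) : Prop :=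
  ∃ C : ℝ, 1 ≤ C ∧ ∀ l : List ℕ, l ≠ [] → (∀ a ∈ l, a ∈ A) → ∀ x ∈ badSet A,
    C⁻¹ * Real.exp (birkhoff φ l.length (invBranch l x)) ≤ (μ (cylinder l)).toReal ∧
      (μ (cylinder l)).toReal ≤ C * Real.exp (birkhoff φ l.length (invBranch l x))

/-- The `n`-regular set `A_n(ε)` of the large deviation decomposition. -/
def regSet (φ : ℝ → ℝ) (lam s ε : ℝ) (n : ℕ) : Set ℝ :=
  {x | |birkhoff gaussPsi n x / (n : ℝ) + lam| < ε ∧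
       |birkhoff φ n x / birkhoff gaussPsi n x - s| < ε}

/-- The collection `𝓡ₙ` of `n`-regular words. -/
def regWords (φ : ℝ → ℝ) (lam s ε : ℝ) (n : ℕ) : Set (List ℕ) :=
  {l | l.length = n ∧ (∀ a ∈ l, 0 < a) ∧
       ∀ k : ℕ, n / 2 ≤ k → k ≤ n → cylinder (l.take k) ⊆ regSet φ lam s ε k}

/-- The union `Rₙ` of the `n`-regular cylinders. -/
def regUnion (φ : ℝ → ℝ) (lam s ε : ℝ) (n : ℕ) : Set ℝ :=
  ⋃ l ∈ regWords φ lam s ε n, cylinder l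

end

lemma lt_one_of_mem_gaussSet {x : ℝ} (hx : x ∈ gaussSet) : x < 1 :=
  lt_of_le_of_ne hx.1.2 hx.2.ne_one

lemma pos_of_mem_gaussSet {x : ℝ} (hx : x ∈ gaussSet) : 0 < x :=
  lt_of_le_of_ne hx.1.1 hx.2.ne_zero.symm

lemma invBranch1_mem {a : ℕ} (ha : 0 < a) {x : ℝ} (hx : x ∈ gaussSet) :
    invBranch1 a x ∈ gaussSet := by
  have h1 : (1 : ℝ) ≤ a := by exact_mod_cast ha
  have h0 := pos_of_mem_gaussSet hx
  refine ⟨⟨?_, ?_⟩, ?_⟩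
  · unfold invBranch1; positivity
  · exact inv_le_one_of_one_le₀ (by linarith)
  · exact (hx.2.add_natCast a).inv

lemma gaussMap_invBranch1 (a : ℕ) {x : ℝ} (hx : x ∈ gaussSet) :
    gaussMap (invBranch1 a x) = x := by
  simp only [gaussMap, invBranch1, inv_inv, Int.fract_add_natCast]
  exact Int.fract_eq_self.2 ⟨hx.1.1, lt_one_of_mem_gaussSet hx⟩

lemma cfDigit1_invBranch1 (a : ℕ) {x : ℝ} (hx : x ∈ gaussSet) :
    cfDigit1 (invBranch1 a x) = a := by
  simp only [cfDigit1, invBranch1, inv_inv]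
  rw [Nat.floor_add_natCast hx.1.1, Nat.floor_eq_zero.2 (lt_one_of_mem_gaussSet hx), zero_add]

lemma gaussMap_mem {x : ℝ} (hx : x ∈ gaussSet) : gaussMap x ∈ gaussSet :=
  ⟨⟨Int.fract_nonneg _, (Int.fract_lt_one _).le⟩, by
    unfold gaussMap Int.fract
    exact hx.2.inv.sub_intCast _⟩

lemma cfDigit1_pos {x : ℝ} (hx : x ∈ gaussSet) : 0 < cfDigit1 x :=
  Nat.floor_pos.2 ((one_le_inv₀ (pos_of_mem_gaussSet hx)).2 hx.1.2)

lemma invBranch1_cfDigit1_gaussMap {x : ℝ} (hx : x ∈ gaussSet) :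
    invBranch1 (cfDigit1 x) (gaussMap x) = x := by
  have h0 := pos_of_mem_gaussSet hx
  have h : ((⌊x⁻¹⌋₊ : ℕ) : ℝ) = ((⌊x⁻¹⌋ : ℤ) : ℝ) :=
    natCast_floor_eq_intCast_floor (by positivity)
  simp only [invBranch1, gaussMap, cfDigit1, h, Int.fract_add_floor, inv_inv]

lemma invBranch_mem {l : List ℕ} (hl : ∀ a ∈ l, 0 < a) {x : ℝ} (hx : x ∈ gaussSet) :
    invBranch l x ∈ gaussSet := by
  induction l with
  | nil => exact hx
  | cons a l ih =>
    exact invBranch1_mem (hl a (by simp)) (ih fun b hb => hl b (by simp [hb]))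

lemma invBranch_mem_cylinder {l : List ℕ} (hl : ∀ a ∈ l, 0 < a) {x : ℝ} (hx : x ∈ gaussSet) :
    invBranch l x ∈ cylinder l := by
  refine ⟨invBranch_mem hl hx, ?_⟩
  induction l with
  | nil => exact fun i => i.elim0
  | cons a l ih =>
    have hl' : ∀ b ∈ l, 0 < b := fun b hb => hl b (by simp [hb])
    have hmem := invBranch_mem hl' hx
    intro i
    refine Fin.cases ?_ (fun j => ?_) i
    · exact cfDigit1_invBranch1 a hmem
    · have h : cfDigit (j + 1) (invBranch (a :: l) x) = cfDigit j (invBranch l x) := by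
        change cfDigit1 (gaussMap^[j + 1] (invBranch1 a (invBranch l x))) = _
        rw [Function.iterate_succ_apply, gaussMap_invBranch1 a hmem]
        rfl
      simpa [h] using ih hl' j

lemma exists_invBranch_of_mem_cylinder {l : List ℕ} {x : ℝ} (hx : x ∈ cylinder l) :
    ∃ y ∈ gaussSet, x = invBranch l y := by
  induction l generalizing x with
  | nil => exact ⟨x, hx.1, rfl⟩
  | cons a l ih =>
    have h0 : cfDigit1 x = a := hx.2 ⟨0, by simp⟩
    have h1 : gaussMap x ∈ cylinder l :=
      ⟨gaussMap_mem hx.1, fun i => hx.2 i.succ⟩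
    obtain ⟨y, hy, hxy⟩ := ih h1
    refine ⟨y, hy, ?_⟩
    change x = invBranch1 a (invBranch l y)
    rw [← hxy, ← h0, invBranch1_cfDigit1_gaussMap hx.1]

/-- The first `n` continued fraction digits of `x`. -/
noncomputable def cfDigits : ℕ → ℝ → List ℕ
  | 0, _ => []
  | n + 1, x => cfDigit1 x :: cfDigits n (gaussMap x)

lemma length_cfDigits (n : ℕ) (x : ℝ) : (cfDigits n x).length = n := by
  induction n generalizing x with
  | zero => rfl
  | succ n ih => simp [cfDigits, ih]

lemma cfDigits_pos (n : ℕ) {x : ℝ} (hx : x ∈ gaussSet) : ∀ a ∈ cfDigits n x, 0 < a := by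
  induction n generalizing x with
  | zero => simp [cfDigits]
  | succ n ih =>
    simp only [cfDigits, List.mem_cons, forall_eq_or_imp]
    exact ⟨cfDigit1_pos hx, ih (gaussMap_mem hx)⟩

lemma mem_cylinder_cfDigits (n : ℕ) {x : ℝ} (hx : x ∈ gaussSet) :
    x ∈ cylinder (cfDigits n x) := by
  suffices ∃ y ∈ gaussSet, invBranch (cfDigits n x) y = x by
    obtain ⟨y, hy, h⟩ := this
    have := invBranch_mem_cylinder (cfDigits_pos n hx) hy
    rwa [h] at this
  induction n generalizing x with
  | zero => exact ⟨x, hx, rfl⟩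
  | succ n ih =>
    obtain ⟨y, hy, h⟩ := ih (gaussMap_mem hx)
    refine ⟨y, hy, ?_⟩
    change invBranch1 (cfDigit1 x) (invBranch (cfDigits n (gaussMap x)) y) = x
    rw [h, invBranch1_cfDigit1_gaussMap hx]

lemma measurable_gaussMap : Measurable gaussMap := measurable_fract.comp measurable_inv

lemma measurable_cfDigit1 : Measurable cfDigit1 := Nat.measurable_floor.comp measurable_inv

lemma measurable_comp_cfDigits (G : List ℕ → ℝ) (n : ℕ) :
    Measurable fun x => G (cfDigits n x) := by
  induction n generalizing G with
  | zero => exact (measurable_const : Measurable fun _ : ℝ => G [])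
  | succ n ih =>
    have h : Measurable fun p : ℕ × ℝ => G (p.1 :: cfDigits n p.2) :=
      measurable_from_prod_countable_right fun a => ih fun l => G (a :: l)
    exact h.comp (measurable_cfDigit1.prodMk measurable_gaussMap)

lemma measurableSet_gaussSet : MeasurableSet gaussSet :=
  measurableSet_Icc.inter (Set.countable_range ((↑) : ℚ → ℝ)).measurableSet.compl

lemma measurableSet_cylinder (l : List ℕ) : MeasurableSet (cylinder l) := by
  have h : cylinder l = gaussSet ∩ ⋂ i : Fin l.length, cfDigit i.1 ⁻¹' {l.get i} := by
    ext x; simp [_root_.cylinder]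
  rw [h]
  exact measurableSet_gaussSet.inter (MeasurableSet.iInter fun i =>
    (measurable_cfDigit1.comp (measurable_gaussMap.iterate _)) (measurableSet_singleton _))

section PeriodicPoint

lemma invBranch_append (l₁ l₂ : List ℕ) (x : ℝ) :
    invBranch (l₁ ++ l₂) x = invBranch l₁ (invBranch l₂ x) := by
  simp [invBranch, List.foldr_append]

lemma invBranch1_mem_Icc {a : ℕ} (ha : 0 < a) {x : ℝ} (hx : x ∈ Set.Icc (0 : ℝ) 1) :
    invBranch1 a x ∈ Set.Ioc (0 : ℝ) 1 := by
  have h1 : (1 : ℝ) ≤ a := by exact_mod_cast ha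
  have h0 := hx.1
  exact ⟨by unfold invBranch1; positivity, inv_le_one_of_one_le₀ (by linarith)⟩

lemma invBranch_mem_Icc {l : List ℕ} (hl : ∀ a ∈ l, 0 < a) {x : ℝ} (hx : x ∈ Set.Icc (0 : ℝ) 1) :
    invBranch l x ∈ Set.Icc (0 : ℝ) 1 := by
  induction l with
  | nil => exact hx
  | cons a l ih =>
    exact Set.Ioc_subset_Icc_self
      (invBranch1_mem_Icc (hl a (by simp)) (ih fun b hb => hl b (by simp [hb])))

lemma abs_invBranch1_sub_le {a : ℕ} (ha : 0 < a) {x y : ℝ} (hx : x ∈ Set.Icc (0 : ℝ) 1)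
    (hy : y ∈ Set.Icc (0 : ℝ) 1) : |invBranch1 a x - invBranch1 a y| ≤ |x - y| := by
  have h1 : (1 : ℝ) ≤ a := by exact_mod_cast ha
  have hx0 : 1 ≤ x + a := by linarith [hx.1]
  have hy0 : 1 ≤ y + a := by linarith [hy.1]
  have h : invBranch1 a x - invBranch1 a y = (y - x) / ((x + a) * (y + a)) := by
    unfold invBranch1; field_simp; ring
  rw [h, abs_div, abs_sub_comm y x, abs_of_pos (by positivity : 0 < (x + a) * (y + a))]
  exact div_le_self (abs_nonneg _) (one_le_mul_of_one_le_of_one_le hx0 hy0)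

lemma abs_invBranch1_comp_sub_le {a b : ℕ} (ha : 0 < a) (hb : 0 < b) {x y : ℝ}
    (hx : x ∈ Set.Icc (0 : ℝ) 1) (hy : y ∈ Set.Icc (0 : ℝ) 1) :
    |invBranch1 a (invBranch1 b x) - invBranch1 a (invBranch1 b y)| ≤ |x - y| / 4 := by
  have ha1 : (1 : ℝ) ≤ a := by exact_mod_cast ha
  have hb1 : (1 : ℝ) ≤ b := by exact_mod_cast hb
  have hx0 : 1 ≤ x + b := by linarith [hx.1]
  have hy0 : 1 ≤ y + b := by linarith [hy.1]
  have hx2 : 2 ≤ 1 + a * (x + b) := by nlinarith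
  have hy2 : 2 ≤ 1 + a * (y + b) := by nlinarith
  have h : invBranch1 a (invBranch1 b x) - invBranch1 a (invBranch1 b y)
      = (x - y) / ((1 + a * (x + b)) * (1 + a * (y + b))) := by
    have hxb : x + b ≠ 0 := by positivity
    have hyb : y + b ≠ 0 := by positivity
    have e : ∀ z : ℝ, 1 ≤ z → (z⁻¹ + (a : ℝ))⁻¹ = z / (1 + a * z) := by
      intro z hz
      have : 0 < z := by linarith
      field_simp
    unfold invBranch1
    rw [e _ hx0, e _ hy0]
    field_simp
    ring
  rw [h, abs_div, abs_of_pos (by positivity : 0 < (1 + a * (x + b)) * (1 + a * (y + b)))]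
  exact div_le_div_of_nonneg_left (abs_nonneg _) (by norm_num) (by nlinarith)

lemma abs_invBranch_sub_le {l : List ℕ} (hl : ∀ a ∈ l, 0 < a) {x y : ℝ}
    (hx : x ∈ Set.Icc (0 : ℝ) 1) (hy : y ∈ Set.Icc (0 : ℝ) 1) :
    |invBranch l x - invBranch l y| ≤ |x - y| := by
  induction l with
  | nil => exact le_rfl
  | cons a l ih =>
    have hl' : ∀ b ∈ l, 0 < b := fun b hb => hl b (by simp [hb])
    exact (abs_invBranch1_sub_le (hl a (by simp)) (invBranch_mem_Icc hl' hx)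
      (invBranch_mem_Icc hl' hy)).trans (ih hl')

lemma abs_invBranch_sub_le_quarter {l : List ℕ} (hl : ∀ a ∈ l, 0 < a) (hlen : 2 ≤ l.length)
    {x y : ℝ} (hx : x ∈ Set.Icc (0 : ℝ) 1) (hy : y ∈ Set.Icc (0 : ℝ) 1) :
    |invBranch l x - invBranch l y| ≤ |x - y| / 4 := by
  match l, hl, hlen with
  | a :: b :: l, hl, _ =>
    have hl' : ∀ c ∈ l, 0 < c := fun c hc => hl c (by simp [hc])
    refine (abs_invBranch1_comp_sub_le (hl a (by simp)) (hl b (by simp))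
      (invBranch_mem_Icc hl' hx) (invBranch_mem_Icc hl' hy)).trans ?_
    have := abs_invBranch_sub_le hl' hx hy
    simp only [invBranch] at this ⊢
    linarith

lemma tendsto_periodicPoint {l : List ℕ} (hl : ∀ a ∈ l, 0 < a) (hne : l ≠ []) :
    Tendsto (fun k : ℕ => invBranch (List.flatten (List.replicate k l)) (1/2 : ℝ)) atTop
      (𝓝 (periodicPoint l)) := by
  set u : ℕ → ℝ := fun k => invBranch (List.flatten (List.replicate k l)) (1/2 : ℝ) with hu
  have hsucc : ∀ k, u (k + 1) = invBranch l (u k) := by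
    intro k
    simp only [hu, List.replicate_succ, List.flatten_cons, invBranch_append]
  have hmem : ∀ k, u k ∈ Set.Icc (0 : ℝ) 1 := by
    intro k
    induction k with
    | zero => simp only [hu]; norm_num [invBranch]
    | succ k ih => rw [hsucc]; exact invBranch_mem_Icc hl ih
  have hlen : 2 ≤ (l ++ l).length := by
    have := List.length_pos_iff.2 hne
    simp; omega
  have hdist : ∀ k, |u k - u (k + 1)| ≤ 2 * (1 / 2 : ℝ) ^ k ∧
      |u (k + 1) - u (k + 2)| ≤ 2 * (1 / 2 : ℝ) ^ (k + 1) := by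
    have hle : ∀ i j, |u i - u j| ≤ 1 := fun i j => by
      rw [abs_le]; constructor <;> linarith [(hmem i).1, (hmem i).2, (hmem j).1, (hmem j).2]
    intro k
    induction k with
    | zero => exact ⟨by linarith [hle 0 1], by linarith [hle 1 2]⟩
    | succ k ih =>
      refine ⟨ih.2, ?_⟩
      have h := abs_invBranch_sub_le_quarter (l := l ++ l) (by simpa using hl) hlen
        (hmem k) (hmem (k + 1))
      rw [invBranch_append, invBranch_append, ← hsucc, ← hsucc, ← hsucc] at h
      refine h.trans ?_
      have := ih.1
      rw [pow_succ, pow_succ]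
      linarith
  have hc : CauchySeq u := cauchySeq_of_le_geometric (1 / 2) 2 (by norm_num) fun k => by
    rw [Real.dist_eq]; exact (hdist k).1
  exact tendsto_nhds_limUnder (cauchySeq_tendsto_of_complete hc)

lemma invBranch_periodicPoint {l : List ℕ} (hl : ∀ a ∈ l, 0 < a) (hne : l ≠ []) :
    periodicPoint l ∈ Set.Icc (0 : ℝ) 1 ∧ invBranch l (periodicPoint l) = periodicPoint l := by
  have hlim := tendsto_periodicPoint hl hne
  have hmem : ∀ k : ℕ, invBranch (List.flatten (List.replicate k l)) (1/2 : ℝ)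
      ∈ Set.Icc (0 : ℝ) 1 := fun k =>
    invBranch_mem_Icc (fun a ha => by
      obtain ⟨m, hm, ham⟩ := List.mem_flatten.1 ha
      rw [List.eq_of_mem_replicate hm] at ham
      exact hl a ham) (by norm_num)
  have hp := isClosed_Icc.mem_of_tendsto hlim (Eventually.of_forall hmem)
  refine ⟨hp, tendsto_nhds_unique ?_ ((tendsto_add_atTop_iff_nat 1).2 hlim)⟩
  rw [tendsto_iff_norm_sub_tendsto_zero] at hlim ⊢
  refine squeeze_zero (fun _ => norm_nonneg _) (fun k => ?_) hlim
  simp only [List.replicate_succ, List.flatten_cons, invBranch_append]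
  exact abs_invBranch_sub_le hl (hmem k) hp

lemma exists_rat_of_invBranch_eq_rat {l : List ℕ} (hl : ∀ a ∈ l, 0 < a) {z : ℝ} (hz : 0 < z)
    {r : ℚ} (h : invBranch l z = r) : ∃ s : ℚ, z = s ∧ s.den + l.length ≤ r.den := by
  have hpos : ∀ l' : List ℕ, 0 < invBranch l' z := by
    intro l'
    induction l' with
    | nil => exact hz
    | cons a l ih =>
      change 0 < (invBranch l z + (a : ℝ))⁻¹
      positivity
  induction l generalizing r with
  | nil => exact ⟨r, h, by simp⟩
  | cons a l ih =>
    have ha : (1 : ℝ) ≤ a := by exact_mod_cast hl a (by simp)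
    have h' : (invBranch l z + (a : ℝ))⁻¹ = r := h
    have hr0 : (0 : ℝ) < r := h' ▸ (by have := hpos l; positivity)
    have hr1 : (r : ℝ) < 1 := h' ▸ inv_lt_one_of_one_lt₀ (by linarith [hpos l])
    have hr0' : 0 < r := by exact_mod_cast hr0
    have hr1' : r < 1 := by exact_mod_cast hr1
    have hw : invBranch l z = ((r⁻¹ - (a : ℤ) : ℚ) : ℝ) := by
      push_cast
      rw [← h', inv_inv]; ring
    obtain ⟨s, hs, hsd⟩ := ih (fun b hb => hl b (by simp [hb])) hw
    refine ⟨s, hs, ?_⟩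
    have hden : (r⁻¹ - (a : ℤ) : ℚ).den = r⁻¹.den := Rat.sub_intCast_den _ _
    have hnum : r⁻¹.den = r.num.natAbs := Rat.den_inv_of_ne_zero hr0'.ne'
    have hlt : r.num.natAbs < r.den := by
      have h1 := Rat.num_lt_denom_iff.2 hr1'
      have h2 := Rat.num_pos.2 hr0'
      omega
    simp only [List.length_cons]
    omega

lemma periodicPoint_mem {l : List ℕ} (hl : ∀ a ∈ l, 0 < a) (hne : l ≠ []) :
    periodicPoint l ∈ gaussSet := by
  obtain ⟨hmem, hfix⟩ := invBranch_periodicPoint hl hne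
  refine ⟨hmem, ?_⟩
  rintro ⟨r, hr⟩
  have hpos : 0 < periodicPoint l := by
    match l, hl, hne with
    | a :: l, hl, _ =>
      rw [← hfix]
      exact (invBranch1_mem_Icc (hl a (by simp))
        (invBranch_mem_Icc (fun b hb => hl b (by simp [hb])) hmem)).1
  obtain ⟨s, hs, hsd⟩ := exists_rat_of_invBranch_eq_rat hl hpos (hfix.trans hr.symm)
  have hrs : s = r := by exact_mod_cast hs.symm.trans hr.symm
  have := List.length_pos_iff.2 hne
  subst hrs
  omega

end PeriodicPoint

section Words

instance countable_word (n : ℕ) : Countable (Word n) :=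
  inferInstanceAs (Countable {l : List ℕ // l.length = n ∧ ∀ a ∈ l, 0 < a})

/-- Words of length `n + 1` are obtained by prepending a digit to a word of length `n`. -/
def wordConsEquiv (n : ℕ) : Word n × ℕ+ ≃ Word (n + 1) where
  toFun p := ⟨p.2 :: p.1.1, by simp [p.1.2.1], by
    simp only [List.mem_cons, forall_eq_or_imp]; exact ⟨p.2.2, p.1.2.2⟩⟩
  invFun w := (⟨w.1.tail, by simp [w.2.1], fun a ha => w.2.2 a (List.mem_of_mem_tail ha)⟩,
    ⟨w.1.head (by intro h; simpa [h] using w.2.1), w.2.2 _ (List.head_mem _)⟩)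
  left_inv p := rfl
  right_inv w := Subtype.ext (List.cons_head_tail _)

lemma tsum_word_succ (F : List ℕ → ℝ≥0∞) (n : ℕ) :
    ∑' w : Word (n + 1), F w.1 = ∑' w : Word n, ∑' a : ℕ+, F (a :: w.1) :=
  ((wordConsEquiv n).tsum_eq fun w : Word (n + 1) => F w.1).symm.trans
    (ENNReal.tsum_prod (f := fun (w : Word n) (a : ℕ+) => F (a :: w.1)))

lemma tsum_word_zero (F : List ℕ → ℝ≥0∞) : ∑' w : Word 0, F w.1 = F [] := by
  have e : ∃ w₀ : Word 0, w₀.1 = [] := ⟨⟨[], by simp⟩, rfl⟩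
  obtain ⟨w₀, h₀⟩ := e
  have hw : ∀ w : Word 0, w = w₀ := fun w =>
    Subtype.ext ((List.length_eq_zero_iff.1 w.2.1).trans h₀.symm)
  have h := tsum_eq_single (L := SummationFilter.unconditional (Word 0))
    (f := fun w : Word 0 => F w.1) w₀ fun w h => absurd (hw w) h
  rw [h, h₀]

lemma birkhoff_cons (ψ : ℝ → ℝ) {a : ℕ} {l : List ℕ} (hl : ∀ b ∈ l, 0 < b)
    {x : ℝ} (hx : x ∈ gaussSet) (n : ℕ) :
    birkhoff ψ (n + 1) (invBranch (a :: l) x)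
      = ψ (invBranch (a :: l) x) + birkhoff ψ n (invBranch l x) := by
  unfold birkhoff
  rw [Finset.sum_range_succ', add_comm]
  congr 1
  refine Finset.sum_congr rfl fun k _ => ?_
  rw [Function.iterate_succ_apply]
  congr 2
  exact gaussMap_invBranch1 a (invBranch_mem hl hx)

/-- The oscillation of `ψ` on cylinders of length `n ≥ 1` is at most `C * θ ^ n`. -/
def WordHolder (C θ : ℝ) (ψ : ℝ → ℝ) : Prop :=
  ∀ l : List ℕ, l ≠ [] → (∀ a ∈ l, 0 < a) → ∀ x ∈ gaussSet, ∀ y ∈ gaussSet,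
    |ψ (invBranch l x) - ψ (invBranch l y)| ≤ C * θ ^ l.length

lemma LocHolder.exists_common {φ f : ℝ → ℝ} (hφ : LocHolder φ) (hf : LocHolder f) :
    ∃ C > (0 : ℝ), ∃ θ ∈ Set.Ioo (0 : ℝ) 1, WordHolder C θ φ ∧ WordHolder C θ f := by
  obtain ⟨C₁, hC₁, θ₁, hθ₁, h₁⟩ := hφ
  obtain ⟨C₂, hC₂, θ₂, hθ₂, h₂⟩ := hf
  refine ⟨max C₁ C₂, lt_max_of_lt_left hC₁, max θ₁ θ₂,
    ⟨lt_max_of_lt_left hθ₁.1, max_lt hθ₁.2 hθ₂.2⟩, ?_, ?_⟩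
  · intro l hne hl x hx y hy
    refine (h₁ l hne hl _ (invBranch_mem_cylinder hl hx) _ (invBranch_mem_cylinder hl hy)).trans ?_
    have := hθ₁.1
    gcongr
    · exact le_max_left _ _
    · exact le_max_left _ _
  · intro l hne hl x hx y hy
    refine (h₂ l hne hl _ (invBranch_mem_cylinder hl hx) _ (invBranch_mem_cylinder hl hy)).trans ?_
    have := hθ₂.1
    gcongr
    · exact le_max_right _ _
    · exact le_max_right _ _

lemma WordHolder.mul_add {C θ : ℝ} {f φ : ℝ → ℝ} (hf : WordHolder C θ f)
    (hφ : WordHolder C θ φ) (t : ℝ) :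
    WordHolder ((|t| + 1) * C) θ (fun x => t * f x + φ x) := by
  intro l hne hl x hx y hy
  have h1 := hf l hne hl x hx y hy
  have h2 := hφ l hne hl x hx y hy
  calc _ = |t * (f (invBranch l x) - f (invBranch l y))
        + (φ (invBranch l x) - φ (invBranch l y))| := by congr 1; ring
    _ ≤ |t| * |f (invBranch l x) - f (invBranch l y)| + |φ (invBranch l x) - φ (invBranch l y)| := by
      rw [← abs_mul]; exact abs_add_le _ _
    _ ≤ |t| * (C * θ ^ l.length) + C * θ ^ l.length := by gcongr
    _ = _ := by ring

lemma WordHolder.birkhoff_distortion {C θ : ℝ} {ψ : ℝ → ℝ} (h : WordHolder C θ ψ) (hC : 0 ≤ C)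
    (hθ : θ ∈ Set.Ioo (0 : ℝ) 1) {l : List ℕ} (hl : ∀ a ∈ l, 0 < a) {x y : ℝ}
    (hx : x ∈ gaussSet) (hy : y ∈ gaussSet) :
    |birkhoff ψ l.length (invBranch l x) - birkhoff ψ l.length (invBranch l y)|
      ≤ C / (1 - θ) := by
  have h1 : 0 < 1 - θ := by linarith [hθ.2]
  suffices |birkhoff ψ l.length (invBranch l x) - birkhoff ψ l.length (invBranch l y)|
      ≤ C / (1 - θ) * (1 - θ ^ (l.length + 1)) by
    refine this.trans (mul_le_of_le_one_right (by positivity) ?_)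
    have := pow_pos hθ.1 (l.length + 1)
    linarith
  induction l with
  | nil =>
    simp [birkhoff]
    field_simp
    exact hC
  | cons a l ih =>
    have hl' : ∀ b ∈ l, 0 < b := fun b hb => hl b (by simp [hb])
    have e := ih hl'
    have e1 := h (a :: l) (by simp) hl x hx y hy
    simp only [List.length_cons] at e1 ⊢
    rw [birkhoff_cons ψ hl' hx, birkhoff_cons ψ hl' hy]
    calc _ = |(ψ (invBranch (a :: l) x) - ψ (invBranch (a :: l) y)) +
          (birkhoff ψ l.length (invBranch l x) - birkhoff ψ l.length (invBranch l y))| := by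
          congr 1; ring
      _ ≤ C * θ ^ (l.length + 1) + C / (1 - θ) * (1 - θ ^ (l.length + 1)) :=
          (abs_add_le _ _).trans (add_le_add e1 e)
      _ = _ := by field_simp; ring

/-- The sum of `exp (S_n ψ)` over all `n`-th preimages of `x`. -/
noncomputable def wordSum (ψ : ℝ → ℝ) (n : ℕ) (x : ℝ) : ℝ≥0∞ :=
  ∑' w : Word n, ENNReal.ofReal (Real.exp (birkhoff ψ n (invBranch w.1 x)))

lemma ofReal_exp_le_mul {a b B : ℝ} (h : |a - b| ≤ B) :
    ENNReal.ofReal (Real.exp a) ≤ ENNReal.ofReal (Real.exp B) * ENNReal.ofReal (Real.exp b) := by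
  rw [← ENNReal.ofReal_mul (Real.exp_pos _).le, ← Real.exp_add]
  refine ENNReal.ofReal_le_ofReal (Real.exp_le_exp.2 ?_)
  linarith [(abs_le.1 h).2]

lemma WordHolder.birkhoff_periodicPoint_distortion {C θ : ℝ} {ψ : ℝ → ℝ}
    (h : WordHolder C θ ψ) (hC : 0 ≤ C) (hθ : θ ∈ Set.Ioo (0 : ℝ) 1) {n : ℕ} (hn : 0 < n)
    (w : Word n) {x : ℝ} (hx : x ∈ gaussSet) :
    |birkhoff ψ n (periodicPoint w.1) - birkhoff ψ n (invBranch w.1 x)| ≤ C / (1 - θ) := by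
  have hne : w.1 ≠ [] := List.length_pos_iff.1 (w.2.1.symm ▸ hn)
  have h1 := h.birkhoff_distortion hC hθ w.2.2 (periodicPoint_mem w.2.2 hne) hx
  rwa [(invBranch_periodicPoint w.2.2 hne).2, w.2.1] at h1

lemma WordHolder.partSum_le {C θ : ℝ} {ψ : ℝ → ℝ} (h : WordHolder C θ ψ) (hC : 0 ≤ C)
    (hθ : θ ∈ Set.Ioo (0 : ℝ) 1) {n : ℕ} (hn : 0 < n) {x : ℝ} (hx : x ∈ gaussSet) :
    partSum ψ n ≤ ENNReal.ofReal (Real.exp (C / (1 - θ))) * wordSum ψ n x := by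
  unfold partSum wordSum
  rw [← ENNReal.tsum_mul_left]
  exact ENNReal.tsum_le_tsum fun w =>
    ofReal_exp_le_mul (h.birkhoff_periodicPoint_distortion hC hθ hn w hx)

lemma WordHolder.wordSum_le {C θ : ℝ} {ψ : ℝ → ℝ} (h : WordHolder C θ ψ) (hC : 0 ≤ C)
    (hθ : θ ∈ Set.Ioo (0 : ℝ) 1) {n : ℕ} (hn : 0 < n) {x : ℝ} (hx : x ∈ gaussSet) :
    wordSum ψ n x ≤ ENNReal.ofReal (Real.exp (C / (1 - θ))) * partSum ψ n := by
  unfold partSum wordSum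
  rw [← ENNReal.tsum_mul_left]
  exact ENNReal.tsum_le_tsum fun w => ofReal_exp_le_mul
    ((abs_sub_comm _ _).trans_le <| h.birkhoff_periodicPoint_distortion hC hθ hn w hx)

lemma wordSum_one (ψ : ℝ → ℝ) (x : ℝ) :
    wordSum ψ 1 x = ∑' a : ℕ+, ENNReal.ofReal (Real.exp (ψ (invBranch1 a x))) := by
  have h1 := tsum_word_succ
    (fun l => ENNReal.ofReal (Real.exp (birkhoff ψ 1 (invBranch l x)))) 0
  have h0 := tsum_word_zero
    (fun l => ∑' a : ℕ+, ENNReal.ofReal (Real.exp (birkhoff ψ 1 (invBranch (a :: l) x))))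
  refine (h1.trans h0).trans ?_
  simp [birkhoff, invBranch]

lemma tsum_word_exp_mul_le {ψ h : ℝ → ℝ} {lam : ℝ} (hlam : 0 ≤ lam)
    (hstep : ∀ y ∈ gaussSet, ∑' a : ℕ+, ENNReal.ofReal
      (Real.exp (ψ (invBranch1 a y)) * h (invBranch1 a y)) ≤ ENNReal.ofReal (lam * h y))
    {x : ℝ} (hx : x ∈ gaussSet) (n : ℕ) :
    ∑' w : Word n, ENNReal.ofReal (Real.exp (birkhoff ψ n (invBranch w.1 x)) *
      h (invBranch w.1 x)) ≤ ENNReal.ofReal (lam ^ n * h x) := by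
  induction n with
  | zero =>
    refine (tsum_word_zero (fun l => ENNReal.ofReal (Real.exp (birkhoff ψ 0 (invBranch l x)) *
      h (invBranch l x)))).trans_le ?_
    simp [birkhoff, invBranch]
  | succ n ih =>
    refine (tsum_word_succ (fun l => ENNReal.ofReal (Real.exp (birkhoff ψ (n + 1) (invBranch l x)) *
      h (invBranch l x))) n).trans_le ?_
    calc _ = ∑' w : Word n, ENNReal.ofReal (Real.exp (birkhoff ψ n (invBranch w.1 x))) *
          ∑' a : ℕ+, ENNReal.ofReal (Real.exp (ψ (invBranch1 a (invBranch w.1 x))) *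
            h (invBranch1 a (invBranch w.1 x))) := by
          refine tsum_congr fun w => ?_
          rw [← ENNReal.tsum_mul_left]
          refine tsum_congr fun a => ?_
          rw [← ENNReal.ofReal_mul (Real.exp_pos _).le]
          congr 1
          change Real.exp (birkhoff ψ (n + 1) (invBranch (a :: w.1) x)) *
            h (invBranch1 a (invBranch w.1 x)) = _
          rw [birkhoff_cons ψ w.2.2 hx, Real.exp_add]
          change Real.exp (ψ (invBranch1 a (invBranch w.1 x))) * _ * _ = _
          ring
      _ ≤ ∑' w : Word n, ENNReal.ofReal lam *
          ENNReal.ofReal (Real.exp (birkhoff ψ n (invBranch w.1 x)) * h (invBranch w.1 x)) := by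
          refine ENNReal.tsum_le_tsum fun w => ?_
          refine (mul_le_mul_right (hstep _ (invBranch_mem w.2.2 hx)) _).trans ?_
          rw [← ENNReal.ofReal_mul hlam, ← ENNReal.ofReal_mul (Real.exp_pos _).le]
          apply le_of_eq
          congr 1; ring
      _ ≤ ENNReal.ofReal lam * ENNReal.ofReal (lam ^ n * h x) := by
          rw [ENNReal.tsum_mul_left]; gcongr
      _ = _ := by rw [← ENNReal.ofReal_mul hlam]; congr 1; ring

end Words

section Transfer

/-- The Ruelle transfer operator of `φ`. -/
noncomputable def transfer (φ u : ℝ → ℝ) (x : ℝ) : ℝ :=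
  ∑' a : ℕ+, Real.exp (φ (invBranch1 a x)) * u (invBranch1 a x)

/-- The oscillation of `u` on cylinders of length `n` is at most `D`. -/
def OscLE (n : ℕ) (D : ℝ) (u : ℝ → ℝ) : Prop :=
  ∀ l : List ℕ, l.length = n → (∀ a ∈ l, 0 < a) → ∀ x ∈ gaussSet, ∀ y ∈ gaussSet,
    |u (invBranch l x) - u (invBranch l y)| ≤ D

lemma oscLE_zero {D : ℝ} {u : ℝ → ℝ} :
    OscLE 0 D u ↔ ∀ x ∈ gaussSet, ∀ y ∈ gaussSet, |u x - u y| ≤ D := by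
  refine ⟨fun h => h [] rfl (by simp), fun h l hl _ _ hx _ hy => ?_⟩
  rw [List.length_eq_zero_iff.1 hl]
  exact h _ hx _ hy

lemma OscLE.of_zero {D : ℝ} {u : ℝ → ℝ} (h : OscLE 0 D u) (n : ℕ) : OscLE n D u :=
  fun _ _ hl _ hx _ hy => oscLE_zero.1 h _ (invBranch_mem hl hx) _ (invBranch_mem hl hy)

lemma OscLE.mono {n : ℕ} {D D' : ℝ} {u : ℝ → ℝ} (h : OscLE n D u) (hD : D ≤ D') :
    OscLE n D' u := fun l h1 h2 x hx y hy => (h l h1 h2 x hx y hy).trans hD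

lemma tsum_mul_sub_tsum_mul_le_of_coupling {ι : Type*} {p q u v : ι → ℝ} {κ D₀ D₁ G : ℝ}
    (hp0 : ∀ a, 0 ≤ p a) (hq0 : ∀ a, 0 ≤ q a) (hp : HasSum p 1) (hq : HasSum q 1) (hκ : 0 ≤ κ)
    (hpq : ∀ a, κ * p a ≤ q a) (hu : ∀ a, |u a| ≤ G) (hv : ∀ a, |v a| ≤ G)
    (h1 : ∀ a, u a - v a ≤ D₁) (h0 : ∀ a b, u a - v b ≤ D₀) :
    ∑' a, p a * u a - ∑' a, q a * v a ≤ κ * D₁ + (1 - κ) * D₀ := by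
  have summ : ∀ {r w : ι → ℝ}, (∀ a, 0 ≤ r a) → HasSum r 1 → (∀ a, |w a| ≤ G) →
      Summable fun a => r a * w a := by
    intro r w hr hs hw
    refine Summable.of_norm_bounded (hs.summable.mul_right G) fun a => ?_
    rw [Real.norm_eq_abs, abs_mul, abs_of_nonneg (hr a)]
    exact mul_le_mul_of_nonneg_left (hw a) (hr a)
  have spu := (summ hp0 hp hu).hasSum
  have spv := (summ hp0 hp hv).hasSum
  have sqv := (summ hq0 hq hv).hasSum
  set U := ∑' a, p a * u a
  set V := ∑' a, p a * v a
  set W := ∑' a, q a * v a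
  have hU : ∀ b, U ≤ 1 * (v b + D₀) := fun b =>
    hasSum_le (fun a => mul_le_mul_of_nonneg_left (by linarith [h0 a b]) (hp0 a)) spu
      (hp.mul_right (v b + D₀))
  have hUV : U - V ≤ 1 * D₁ :=
    hasSum_le (fun a => by nlinarith [h1 a, hp0 a]) (spu.sub spv) (hp.mul_right D₁)
  have hW : (1 - κ * 1) * (U - D₀) ≤ W - κ * V := by
    refine hasSum_le (fun a => ?_) ((hq.sub (hp.mul_left κ)).mul_right (U - D₀))
      (sqv.sub (spv.mul_left κ))
    have := hU a
    have := hpq a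
    nlinarith
  nlinarith

lemma TransferNormalized.hasSum {φ : ℝ → ℝ} (hL : TransferNormalized φ) {x : ℝ}
    (hx : x ∈ gaussSet) : HasSum (fun a : ℕ+ => Real.exp (φ (invBranch1 a x))) 1 := by
  have h := hL x hx
  rw [← h]
  refine Summable.hasSum ?_
  by_contra hs
  rw [tsum_eq_zero_of_not_summable hs] at h
  exact zero_ne_one h

lemma abs_transfer_le {φ u : ℝ → ℝ} (hL : TransferNormalized φ) {G : ℝ}
    (hu : ∀ x ∈ gaussSet, |u x| ≤ G) : ∀ x ∈ gaussSet, |transfer φ u x| ≤ G := by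
  intro x hx
  have h := tsum_of_norm_bounded (f := fun a : ℕ+ =>
    Real.exp (φ (invBranch1 a x)) * u (invBranch1 a x)) ((hL.hasSum hx).mul_right G) fun a => by
      rw [Real.norm_eq_abs, abs_mul, abs_of_pos (Real.exp_pos _)]
      exact mul_le_mul_of_nonneg_left (hu _ (invBranch1_mem a.2 hx)) (Real.exp_pos _).le
  rwa [one_mul] at h

lemma WordHolder.abs_sub_cons_le {C θ : ℝ} {φ : ℝ → ℝ} (h : WordHolder C θ φ) {l : List ℕ}
    (hl : ∀ a ∈ l, 0 < a) (a : ℕ+) {x y : ℝ} (hx : x ∈ gaussSet) (hy : y ∈ gaussSet) :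
    |φ (invBranch1 a (invBranch l x)) - φ (invBranch1 a (invBranch l y))|
      ≤ C * θ ^ (l.length + 1) :=
  h ((a : ℕ) :: l) (by simp)
    (by simp only [List.mem_cons, forall_eq_or_imp]; exact ⟨a.2, hl⟩) x hx y hy

lemma oscLE_transfer {φ u : ℝ → ℝ} {C θ G D₀ D₁ : ℝ} {n : ℕ} (hL : TransferNormalized φ)
    (hφ : WordHolder C θ φ) (hu : ∀ x ∈ gaussSet, |u x| ≤ G) (h0 : OscLE 0 D₀ u)
    (h1 : OscLE (n + 1) D₁ u) :
    OscLE n (Real.exp (-(C * θ ^ (n + 1))) * D₁ + (1 - Real.exp (-(C * θ ^ (n + 1)))) * D₀)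
      (transfer φ u) := by
  have key : ∀ l : List ℕ, l.length = n → (∀ a ∈ l, 0 < a) → ∀ x ∈ gaussSet, ∀ y ∈ gaussSet,
      transfer φ u (invBranch l x) - transfer φ u (invBranch l y)
        ≤ Real.exp (-(C * θ ^ (n + 1))) * D₁ + (1 - Real.exp (-(C * θ ^ (n + 1)))) * D₀ := by
    intro l hn hl x hx y hy
    have hlx := invBranch_mem hl hx
    have hly := invBranch_mem hl hy
    refine tsum_mul_sub_tsum_mul_le_of_coupling (G := G) (fun a => (Real.exp_pos _).le)
      (fun a => (Real.exp_pos _).le)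
      (hL.hasSum hlx) (hL.hasSum hly) (Real.exp_pos _).le (fun a => ?_)
      (fun a => hu _ (invBranch1_mem a.2 hlx)) (fun a => hu _ (invBranch1_mem a.2 hly))
      (fun a => ?_) (fun a b => ?_)
    · rw [← Real.exp_add]
      have := (abs_le.1 (hφ.abs_sub_cons_le hl a hx hy)).2
      rw [hn] at this
      exact Real.exp_le_exp.2 (by linarith)
    · exact (le_abs_self _).trans (h1 ((a : ℕ) :: l) (by simp [hn])
        (by simp only [List.mem_cons, forall_eq_or_imp]; exact ⟨a.2, hl⟩) x hx y hy)
    · exact (le_abs_self _).trans (oscLE_zero.1 h0 _ (invBranch1_mem a.2 hlx) _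
        (invBranch1_mem b.2 hly))
  intro l hn hl x hx y hy
  rw [abs_sub_le_iff]
  exact ⟨key l hn hl x hx y hy, key l hn hl y hy x hx⟩

lemma abs_iterate_transfer_le {φ u : ℝ → ℝ} (hL : TransferNormalized φ) {G : ℝ}
    (hu : ∀ x ∈ gaussSet, |u x| ≤ G) (i : ℕ) :
    ∀ x ∈ gaussSet, |(transfer φ)^[i] u x| ≤ G := by
  induction i with
  | zero => exact hu
  | succ i ih => rw [Function.iterate_succ_apply']; exact abs_transfer_le hL ih

lemma oscLE_iterate_transfer {φ u : ℝ → ℝ} {C θ G D : ℝ} (hL : TransferNormalized φ)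
    (hφ : WordHolder C θ φ) (hu : ∀ x ∈ gaussSet, |u x| ≤ G) (h0 : OscLE 0 D u) (i : ℕ) :
    OscLE 0 D ((transfer φ)^[i] u) := by
  induction i with
  | zero => exact h0
  | succ i ih =>
    rw [Function.iterate_succ_apply']
    exact (oscLE_transfer hL hφ (abs_iterate_transfer_le hL hu i) ih (ih.of_zero 1)).mono
      (by linarith)

lemma oscLE_iterate_transfer_geometric {φ u : ℝ → ℝ} {C θ G A D : ℝ} (hL : TransferNormalized φ)
    (hφ : WordHolder C θ φ) (hC : 0 ≤ C) (hθ : θ ∈ Set.Ioo (0 : ℝ) 1)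
    (hu : ∀ x ∈ gaussSet, |u x| ≤ G) (h0 : OscLE 0 D u) (hD : 0 ≤ D) (hA : 0 ≤ A)
    (hAD : C * θ * D ≤ A * (1 - θ))
    (h : ∀ n, OscLE n (A * θ ^ n) u) (i : ℕ) :
    ∀ n, OscLE n (A * θ ^ n) ((transfer φ)^[i] u) := by
  induction i with
  | zero => exact h
  | succ i ih =>
    intro n
    rw [Function.iterate_succ_apply']
    refine (oscLE_transfer hL hφ (abs_iterate_transfer_le hL hu i)
      (oscLE_iterate_transfer hL hφ hu h0 i) (ih (n + 1))).mono ?_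
    have hθn := pow_pos hθ.1 n
    have h1 : Real.exp (-(C * θ ^ (n + 1))) ≤ 1 :=
      Real.exp_le_one_iff.2 (neg_nonpos.2 (mul_nonneg hC (pow_pos hθ.1 _).le))
    have h2 := Real.add_one_le_exp (-(C * θ ^ (n + 1)))
    have h3 : Real.exp (-(C * θ ^ (n + 1))) * (A * θ ^ (n + 1)) ≤ A * θ ^ (n + 1) :=
      mul_le_of_le_one_left (mul_nonneg hA (pow_pos hθ.1 _).le) h1
    have h4 : (1 - Real.exp (-(C * θ ^ (n + 1)))) * D ≤ C * θ ^ (n + 1) * D :=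
      mul_le_mul_of_nonneg_right (by linarith) hD
    have h5 := mul_le_mul_of_nonneg_right hAD hθn.le
    rw [pow_succ] at *
    linarith

lemma oscLE_iterate_transfer_of_geometric {φ u : ℝ → ℝ} {C θ G A D : ℝ}
    (hL : TransferNormalized φ)
    (hφ : WordHolder C θ φ) (hC : 0 ≤ C) (hθ : θ ∈ Set.Ioo (0 : ℝ) 1)
    (hu : ∀ x ∈ gaussSet, |u x| ≤ G) (h0 : OscLE 0 D u) (hD : 0 ≤ D) (hA : 0 ≤ A)
    (h : ∀ n, OscLE n (A * θ ^ n) u) (i : ℕ) :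
    ∀ j, OscLE j (A * θ ^ (j + i) + (1 - Real.exp (-(C * θ / (1 - θ) * θ ^ j))) * D)
      ((transfer φ)^[i] u) := by
  have h1θ : 0 < 1 - θ := by linarith [hθ.2]
  induction i with
  | zero =>
    intro j
    refine (h j).mono (le_add_of_nonneg_right (mul_nonneg (sub_nonneg.2 ?_) hD))
    have := hθ.1
    exact Real.exp_le_one_iff.2 (neg_nonpos.2 (by positivity))
  | succ i ih =>
    intro j
    rw [Function.iterate_succ_apply']
    refine (oscLE_transfer hL hφ (abs_iterate_transfer_le hL hu i)
      (oscLE_iterate_transfer hL hφ hu h0 i) (ih (j + 1))).mono ?_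
    have hexp : Real.exp (-(C * θ ^ (j + 1))) * Real.exp (-(C * θ / (1 - θ) * θ ^ (j + 1)))
        = Real.exp (-(C * θ / (1 - θ) * θ ^ j)) := by
      rw [← Real.exp_add]
      congr 1
      field_simp
      ring
    have h1 : Real.exp (-(C * θ ^ (j + 1))) ≤ 1 :=
      Real.exp_le_one_iff.2 (neg_nonpos.2 (mul_nonneg hC (pow_pos hθ.1 _).le))
    have h3 : Real.exp (-(C * θ ^ (j + 1))) * (A * θ ^ (j + 1 + i)) ≤ A * θ ^ (j + 1 + i) :=
      mul_le_of_le_one_left (mul_nonneg hA (pow_pos hθ.1 _).le) h1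
    rw [show j + (i + 1) = j + 1 + i by ring, ← hexp]
    linarith

lemma exists_oscLE_iterate_transfer {φ u : ℝ → ℝ} {C θ G A D : ℝ} (hL : TransferNormalized φ)
    (hφ : WordHolder C θ φ) (hC : 0 ≤ C) (hθ : θ ∈ Set.Ioo (0 : ℝ) 1)
    (hu : ∀ x ∈ gaussSet, |u x| ≤ G) (h0 : OscLE 0 D u) (hD : 0 ≤ D) (hA : 0 ≤ A)
    (hAD : C * θ * D ≤ A * (1 - θ)) (h : ∀ n, OscLE n (A * θ ^ n) u) {ε : ℝ} (hε : 0 < ε) :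
    ∃ N, OscLE 0 ε ((transfer φ)^[N] u) := by
  have h1θ : 0 < 1 - θ := by linarith [hθ.2]
  set γ := 1 - Real.exp (-(C * θ / (1 - θ))) with hγ
  have hγ1 : γ < 1 := by linarith [Real.exp_pos (-(C * θ / (1 - θ)))]
  have hγ0 : 0 ≤ γ := by
    have := hθ.1
    exact sub_nonneg.2 (Real.exp_le_one_iff.2 (neg_nonpos.2 (by positivity)))
  obtain ⟨n, hn⟩ : ∃ n, A * θ ^ n ≤ (1 - γ) * (ε / 2) := by
    have ht := (tendsto_pow_atTop_nhds_zero_of_lt_one hθ.1.le hθ.2).const_mul A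
    rw [mul_zero] at ht
    have hpos : 0 < (1 - γ) * (ε / 2) := mul_pos (by linarith) (by linarith)
    exact (ht.eventually_le_const hpos).exists
  have hm : ∀ m, OscLE 0 (ε / 2 + γ ^ m * D) ((transfer φ)^[n * m] u) := by
    intro m
    induction m with
    | zero => exact h0.mono (by simp; linarith)
    | succ m ih =>
      have hDm : 0 ≤ ε / 2 + γ ^ m * D := by positivity
      have := oscLE_iterate_transfer_of_geometric hL hφ hC hθ
        (abs_iterate_transfer_le hL hu (n * m)) ih hDm hA
        (oscLE_iterate_transfer_geometric hL hφ hC hθ hu h0 hD hA hAD h (n * m)) n 0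
      rw [← Function.iterate_add_apply, pow_zero, mul_one, ← hγ, zero_add] at this
      rw [show n * (m + 1) = n + n * m by ring]
      refine this.mono ?_
      rw [pow_succ]
      linarith
  obtain ⟨m, hm'⟩ : ∃ m, γ ^ m * D ≤ ε / 2 := by
    have ht := (tendsto_pow_atTop_nhds_zero_of_lt_one hγ0 hγ1).mul_const D
    rw [zero_mul] at ht
    exact (ht.eventually_le_const (by linarith : (0:ℝ) < ε / 2)).exists
  exact ⟨n * m, (hm m).mono (by linarith)⟩

lemma oscLE_transfer_of_summable {φ f : ℝ → ℝ} {C θ M : ℝ} (hL : TransferNormalized φ)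
    (hφ : WordHolder C θ φ) (hf : WordHolder C θ f) (hC : 0 ≤ C) (hθ : θ ∈ Set.Ioo (0 : ℝ) 1)
    (hsum : ∀ x ∈ gaussSet,
      Summable fun a : ℕ+ => Real.exp (φ (invBranch1 a x)) * |f (invBranch1 a x)|)
    (hM : ∀ x ∈ gaussSet, transfer φ (fun y => |f y|) x ≤ M) (n : ℕ) :
    OscLE n (θ * (C + C * Real.exp C * M) * θ ^ n) (transfer φ f) := by
  have hsum' : ∀ x ∈ gaussSet,
      Summable fun a : ℕ+ => Real.exp (φ (invBranch1 a x)) * f (invBranch1 a x) := fun x hx =>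
    (hsum x hx).of_norm_bounded fun a => by
      rw [Real.norm_eq_abs, abs_mul, abs_of_pos (Real.exp_pos _)]
  have key : ∀ l : List ℕ, l.length = n → (∀ a ∈ l, 0 < a) → ∀ x ∈ gaussSet, ∀ y ∈ gaussSet,
      transfer φ f (invBranch l x) - transfer φ f (invBranch l y)
        ≤ θ * (C + C * Real.exp C * M) * θ ^ n := by
    intro l hn hl x hx y hy
    have hlx := invBranch_mem hl hx
    have hly := invBranch_mem hl hy
    set s := C * θ ^ (n + 1) with hs
    have hs0 : 0 ≤ s := mul_nonneg hC (pow_pos hθ.1 _).le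
    have hsC : s ≤ C := mul_le_of_le_one_right hC (pow_le_one₀ hθ.1.le hθ.2.le)
    have hexp : Real.exp s - 1 ≤ s * Real.exp C := by
      have h1 := Real.add_one_le_exp (-s)
      have h2 : Real.exp s * Real.exp (-s) = 1 := by rw [← Real.exp_add]; simp
      have h3 := Real.exp_le_exp.2 hsC
      nlinarith [Real.exp_pos s]
    have hle := hasSum_le (fun a : ℕ+ => (?_ : _ ≤ _))
      ((hsum' _ hlx).hasSum.sub (hsum' _ hly).hasSum)
      (((hL.hasSum hlx).mul_right s).add ((hsum _ hly).hasSum.mul_right (Real.exp s - 1)))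
    · refine hle.trans ?_
      have h1 := hM _ hly
      have h0 : 0 ≤ transfer φ (fun y => |f y|) (invBranch l y) :=
        tsum_nonneg fun a => mul_nonneg (Real.exp_pos _).le (abs_nonneg _)
      have h2 : transfer φ (fun y => |f y|) (invBranch l y) * (Real.exp s - 1)
          ≤ M * (s * Real.exp C) :=
        mul_le_mul h1 hexp (sub_nonneg.2 (Real.one_le_exp hs0)) (h0.trans h1)
      change 1 * s + transfer φ (fun y => |f y|) (invBranch l y) * (Real.exp s - 1) ≤ _
      refine (add_le_add_right h2 _).trans (le_of_eq ?_)
      rw [hs, pow_succ]; ring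
    · have hφa := hφ.abs_sub_cons_le hl a hx hy
      have hfa := (abs_le.1 (hf.abs_sub_cons_le hl a hx hy)).2
      rw [hn, ← hs] at hφa hfa
      set p := Real.exp (φ (invBranch1 a (invBranch l x)))
      set q := Real.exp (φ (invBranch1 a (invBranch l y))) with hq
      set v := f (invBranch1 a (invBranch l y))
      have hp0 : 0 < p := Real.exp_pos _
      have hq0 : 0 < q := Real.exp_pos _
      have h1 : p ≤ q * Real.exp s := by
        rw [hq, ← Real.exp_add]; exact Real.exp_le_exp.2 (by linarith [(abs_le.1 hφa).2])
      have h2 : q ≤ p * Real.exp s := by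
        rw [hq, ← Real.exp_add]; exact Real.exp_le_exp.2 (by linarith [(abs_le.1 hφa).1])
      have hs1 := Real.one_le_exp hs0
      have h3 : |p - q| ≤ q * (Real.exp s - 1) := by
        rw [abs_le]
        refine ⟨?_, by linarith⟩
        by_cases hpq : p ≤ q
        · nlinarith
        · nlinarith
      have h4 : (p - q) * v ≤ q * (Real.exp s - 1) * |v| :=
        (le_abs_self _).trans (by rw [abs_mul]; gcongr)
      have h5 := mul_le_mul_of_nonneg_left hfa hp0.le
      linarith
  intro l hn hl x hx y hy
  rw [abs_sub_le_iff]
  exact ⟨key l hn hl x hx y hy, key l hn hl y hy x hx⟩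

end Transfer

section Perturbation

lemma exp_le_one_add_add_sq_mul_exp_abs (z : ℝ) :
    Real.exp z ≤ 1 + z + z ^ 2 * Real.exp |z| := by
  rcases le_or_gt |z| 1 with h | h
  · have h1 := (abs_le.1 (Real.abs_exp_sub_one_sub_id_le h)).2
    nlinarith [Real.one_le_exp (abs_nonneg z), sq_nonneg z]
  · rcases lt_abs.1 h with hz | hz
    · rw [abs_of_pos (by linarith)]
      have h1 : 1 ≤ z ^ 2 := by nlinarith
      nlinarith [Real.exp_pos z]
    · have h1 : Real.exp z ≤ 1 := Real.exp_le_one_iff.2 (by linarith)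
      nlinarith [Real.one_le_exp (abs_nonneg z), sq_nonneg z]

lemma exp_mul_mul_one_add_le {τ t f g G : ℝ} (hτ : 0 < τ) (ht : |t| ≤ τ / 2) (hg : |g| ≤ G)
    (htG : |t| * G ≤ 1 / 2) :
    Real.exp (t * f) * (1 + t * g)
      ≤ 1 + t * (f + g) + t ^ 2 * (16 / τ ^ 2 + G / τ) * Real.exp (τ * |f|) := by
  set E := Real.exp (τ * |f|) with hE
  have htg : |t * g| ≤ 1 / 2 := by
    rw [abs_mul]; exact (mul_le_mul_of_nonneg_left hg (abs_nonneg t)).trans htG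
  have hf : |f| ≤ E / τ := by
    rw [le_div_iff₀ hτ]
    have := Real.add_one_le_exp (τ * |f|)
    linarith
  have hsq : f ^ 2 * Real.exp (τ / 2 * |f|) ≤ 8 / τ ^ 2 * E := by
    have h1 := Real.quadratic_le_exp_of_nonneg (x := τ / 2 * |f|) (by positivity)
    have h2 : f ^ 2 ≤ 8 / τ ^ 2 * Real.exp (τ / 2 * |f|) := by
      rw [div_mul_eq_mul_div, le_div_iff₀ (by positivity), ← sq_abs f]
      have : 0 ≤ τ * |f| := by positivity
      nlinarith
    have h3 : E = Real.exp (τ / 2 * |f|) * Real.exp (τ / 2 * |f|) := by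
      rw [hE, ← Real.exp_add]; congr 1; ring
    rw [h3, ← mul_assoc]
    gcongr
  have h1 : Real.exp (t * f) ≤ 1 + t * f + t ^ 2 * (8 / τ ^ 2 * E) := by
    refine (exp_le_one_add_add_sq_mul_exp_abs _).trans ?_
    have h2 : Real.exp |t * f| ≤ Real.exp (τ / 2 * |f|) := by
      rw [abs_mul]; gcongr
    calc 1 + t * f + (t * f) ^ 2 * Real.exp |t * f|
        ≤ 1 + t * f + (t * f) ^ 2 * Real.exp (τ / 2 * |f|) := by gcongr
      _ = 1 + t * f + t ^ 2 * (f ^ 2 * Real.exp (τ / 2 * |f|)) := by ring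
      _ ≤ _ := by gcongr
  have hfg : f * g ≤ E / τ * G :=
    (le_abs_self _).trans (by rw [abs_mul]; gcongr)
  have hlo := (abs_le.1 htg).1
  have hhi := (abs_le.1 htg).2
  calc Real.exp (t * f) * (1 + t * g)
      ≤ (1 + t * f + t ^ 2 * (8 / τ ^ 2 * E)) * (1 + t * g) := by gcongr; linarith
    _ = 1 + t * (f + g) + t ^ 2 * (f * g) + t ^ 2 * (8 / τ ^ 2 * E) * (1 + t * g) := by ring
    _ ≤ 1 + t * (f + g) + t ^ 2 * (E / τ * G) + t ^ 2 * (8 / τ ^ 2 * E) * 2 := by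
        gcongr; linarith
    _ = _ := by ring

lemma hasSum_transfer_add_sum_iterate {φ f : ℝ → ℝ} {G : ℝ} (hL : TransferNormalized φ)
    (hsum : ∀ x ∈ gaussSet,
      Summable fun a : ℕ+ => Real.exp (φ (invBranch1 a x)) * f (invBranch1 a x))
    (hG : ∀ x ∈ gaussSet, |transfer φ f x| ≤ G) (N : ℕ) {x : ℝ} (hx : x ∈ gaussSet) :
    HasSum (fun a : ℕ+ => Real.exp (φ (invBranch1 a x)) * (f (invBranch1 a x) +
      ∑ k ∈ Finset.range N, (transfer φ)^[k] (transfer φ f) (invBranch1 a x)))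
      (∑ k ∈ Finset.range N, (transfer φ)^[k] (transfer φ f) x
        + (transfer φ)^[N] (transfer φ f) x) := by
  induction N with
  | zero =>
    have : HasSum _ (transfer φ f x) := (hsum x hx).hasSum
    simpa using this
  | succ N ih =>
    have hs : HasSum (fun a : ℕ+ => Real.exp (φ (invBranch1 a x)) *
        (transfer φ)^[N] (transfer φ f) (invBranch1 a x))
        ((transfer φ)^[N + 1] (transfer φ f) x) := by
      rw [Function.iterate_succ_apply']
      refine Summable.hasSum (Summable.of_norm_bounded
        ((hL.hasSum hx).summable.mul_right G) fun a => ?_)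
      rw [Real.norm_eq_abs, abs_mul, abs_of_pos (Real.exp_pos _)]
      exact mul_le_mul_of_nonneg_left
        (abs_iterate_transfer_le hL hG N _ (invBranch1_mem a.2 hx)) (Real.exp_pos _).le
    have := ih.add hs
    simp only [Finset.sum_range_succ]
    convert this using 2
    ring

lemma exists_perturbed_subeigenfunction {φ f : ℝ → ℝ} {C θ τ M : ℝ} (hL : TransferNormalized φ)
    (hφ : WordHolder C θ φ) (hf : WordHolder C θ f) (hC : 0 ≤ C) (hθ : θ ∈ Set.Ioo (0 : ℝ) 1)
    (hτ : 0 < τ) (hX : gaussSet.Nonempty)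
    (hsum : ∀ x ∈ gaussSet,
      Summable fun a : ℕ+ => Real.exp (φ (invBranch1 a x)) * Real.exp (τ * |f (invBranch1 a x)|))
    (hM : ∀ x ∈ gaussSet, transfer φ (fun y => Real.exp (τ * |f y|)) x ≤ M)
    {ε : ℝ} (hε : 0 < ε) :
    ∃ c : ℝ, ∃ t₁ > (0 : ℝ), ∀ t : ℝ, |t| ≤ t₁ → ∃ h : ℝ → ℝ,
      (∀ x ∈ gaussSet, 1 / 2 ≤ h x ∧ h x ≤ 2) ∧
      ∀ x ∈ gaussSet, ∑' a : ℕ+, ENNReal.ofReal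
        (Real.exp (t * f (invBranch1 a x) + φ (invBranch1 a x)) * h (invBranch1 a x))
          ≤ ENNReal.ofReal (Real.exp (t * c + 2 * ε * |t|) * h x) := by
  obtain ⟨x₀, hx₀⟩ := hX
  have hθ1 : 0 < 1 - θ := by linarith [hθ.2]
  have hM0 : 0 ≤ M := (tsum_nonneg fun a => by positivity).trans (hM x₀ hx₀)
  have hfE : ∀ y, |f y| ≤ Real.exp (τ * |f y|) * τ⁻¹ := fun y => by
    rw [← div_eq_mul_inv, le_div_iff₀ hτ]
    have := Real.add_one_le_exp (τ * |f y|)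
    linarith
  have hterm : ∀ x, ∀ a : ℕ+, Real.exp (φ (invBranch1 a x)) * |f (invBranch1 a x)|
      ≤ Real.exp (φ (invBranch1 a x)) * Real.exp (τ * |f (invBranch1 a x)|) * τ⁻¹ := fun x a => by
    rw [mul_assoc]
    exact mul_le_mul_of_nonneg_left (hfE _) (Real.exp_pos _).le
  have hsumabs : ∀ x ∈ gaussSet,
      Summable fun a : ℕ+ => Real.exp (φ (invBranch1 a x)) * |f (invBranch1 a x)| := fun x hx =>
    Summable.of_nonneg_of_le (fun a => by positivity) (hterm x) ((hsum x hx).mul_right _)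
  have hsumf : ∀ x ∈ gaussSet,
      Summable fun a : ℕ+ => Real.exp (φ (invBranch1 a x)) * f (invBranch1 a x) := fun x hx =>
    (hsumabs x hx).of_norm_bounded fun a => by
      rw [Real.norm_eq_abs, abs_mul, abs_of_pos (Real.exp_pos _)]
  set M' := M * τ⁻¹ with hM'
  have hM'0 : 0 ≤ M' := by positivity
  have hMabs : ∀ x ∈ gaussSet, transfer φ (fun y => |f y|) x ≤ M' := fun x hx =>
    (hasSum_le (hterm x) (hsumabs x hx).hasSum ((hsum x hx).hasSum.mul_right τ⁻¹)).trans
      (mul_le_mul_of_nonneg_right (hM x hx) (by positivity))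
  have hu : ∀ x ∈ gaussSet, |transfer φ f x| ≤ M' := fun x hx => by
    have h := norm_tsum_le_tsum_norm (f := fun a : ℕ+ =>
      Real.exp (φ (invBranch1 a x)) * f (invBranch1 a x)) (hsumf x hx).norm
    refine h.trans (le_trans (le_of_eq (tsum_congr fun a => ?_)) (hMabs x hx))
    rw [Real.norm_eq_abs, abs_mul, abs_of_pos (Real.exp_pos _)]
  have hosc0 : OscLE 0 (2 * M') (transfer φ f) := oscLE_zero.2 fun x hx y hy => by
    have h1 := abs_le.1 (hu x hx)
    have h2 := abs_le.1 (hu y hy)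
    rw [abs_le]; constructor <;> linarith [h1.1, h1.2, h2.1, h2.2]
  set A := max (θ * (C + C * Real.exp C * M')) (C * θ * (2 * M') / (1 - θ)) with hA
  have hθ0 := hθ.1
  have hA0 : 0 ≤ A := le_max_of_le_left (by positivity)
  obtain ⟨N, hN⟩ := exists_oscLE_iterate_transfer hL hφ hC hθ hu hosc0 (by positivity) hA0
    ((div_le_iff₀ hθ1).1 (le_max_right _ _))
    (fun n => (oscLE_transfer_of_summable hL hφ hf hC hθ hsumabs hMabs n).mono
      (mul_le_mul_of_nonneg_right (le_max_left _ _) (pow_nonneg hθ.1.le n))) hε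
  set c := (transfer φ)^[N] (transfer φ f) x₀ with hc
  set g : ℝ → ℝ := fun x => ∑ k ∈ Finset.range N, (transfer φ)^[k] (transfer φ f) x with hg
  set G := N * M' + 1 with hG
  have hG0 : 0 < G := by positivity
  have hgG : ∀ x ∈ gaussSet, |g x| ≤ G := fun x hx => by
    refine (Finset.abs_sum_le_sum_abs _ _).trans ?_
    refine (Finset.sum_le_sum fun k _ => abs_iterate_transfer_le hL hu k x hx).trans ?_
    simp [hG]
  set K := 16 / τ ^ 2 + G / τ with hK
  have hK0 : 0 ≤ K := by positivity
  set R := K * M + G * (|c| + 2 * ε) with hR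
  have hR0 : 0 < R := by positivity
  refine ⟨c, min (τ / 2) (min (1 / (2 * G)) (ε / R)), by positivity, fun t ht => ?_⟩
  have ht1 : |t| ≤ τ / 2 := ht.trans (min_le_left _ _)
  have ht2 : |t| * G ≤ 1 / 2 := by
    have := ht.trans ((min_le_right _ _).trans (min_le_left _ _))
    rw [le_div_iff₀ (by positivity)] at this
    linarith
  have ht3 : |t| * R ≤ ε :=
    (le_div_iff₀ hR0).1 (ht.trans ((min_le_right _ _).trans (min_le_right _ _)))
  have htg : ∀ x ∈ gaussSet, |t * g x| ≤ 1 / 2 := fun x hx => by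
    rw [abs_mul]
    exact (mul_le_mul_of_nonneg_left (hgG x hx) (abs_nonneg t)).trans ht2
  refine ⟨fun x => 1 + t * g x, fun x hx => ?_, fun x hx => ?_⟩
  · have := abs_le.1 (htg x hx)
    constructor <;> linarith [this.1, this.2]
  set s := t * c + 2 * ε * |t| with hs
  have hpt : ∀ a : ℕ+, Real.exp (t * f (invBranch1 a x) + φ (invBranch1 a x)) *
      (1 + t * g (invBranch1 a x)) ≤ Real.exp (φ (invBranch1 a x)) +
        t * (Real.exp (φ (invBranch1 a x)) * (f (invBranch1 a x) + g (invBranch1 a x))) +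
        t ^ 2 * K * (Real.exp (φ (invBranch1 a x)) * Real.exp (τ * |f (invBranch1 a x)|)) := by
    intro a
    have h := exp_mul_mul_one_add_le (f := f (invBranch1 a x)) hτ ht1
      (hgG (invBranch1 a x) (invBranch1_mem a.2 hx)) ht2
    rw [Real.exp_add, mul_comm (Real.exp (t * _)), mul_assoc]
    refine (mul_le_mul_of_nonneg_left h (Real.exp_pos _).le).trans (le_of_eq ?_)
    rw [hK]
    ring
  have hpos : ∀ a : ℕ+, 0 ≤ Real.exp (t * f (invBranch1 a x) + φ (invBranch1 a x)) *
      (1 + t * g (invBranch1 a x)) := fun a => by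
    have := (abs_le.1 (htg (invBranch1 a x) (invBranch1_mem a.2 hx))).1
    exact mul_nonneg (Real.exp_pos _).le (by linarith)
  have hbig := ((hL.hasSum hx).add ((hasSum_transfer_add_sum_iterate hL hsumf hu N hx).mul_left
    t)).add ((hsum x hx).hasSum.mul_left (t ^ 2 * K))
  refine (ENNReal.tsum_le_tsum fun a => ENNReal.ofReal_le_ofReal (hpt a)).trans ?_
  rw [← ENNReal.ofReal_tsum_of_nonneg (fun a => (hpos a).trans (hpt a)) hbig.summable,
    hbig.tsum_eq]
  apply ENNReal.ofReal_le_ofReal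
  set v := (transfer φ)^[N] (transfer φ f) x with hv
  have hvc : |v - c| ≤ ε := oscLE_zero.1 hN x hx x₀ hx₀
  have h1 : t * v ≤ t * c + |t| * ε := by
    have : t * (v - c) ≤ |t| * ε := (le_abs_self _).trans (by rw [abs_mul]; gcongr)
    linarith
  have h2 : t ^ 2 * K * transfer φ (fun y => Real.exp (τ * |f y|)) x ≤ t ^ 2 * K * M :=
    mul_le_mul_of_nonneg_left (hM x hx) (by positivity)
  have hsabs : |s| ≤ |t| * (|c| + 2 * ε) := by
    refine (abs_add_le _ _).trans (le_of_eq ?_)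
    rw [abs_mul, abs_mul, abs_abs, abs_of_pos (by positivity : 0 < 2 * ε)]; ring
  have h3 : -(t ^ 2 * (G * (|c| + 2 * ε))) ≤ t * g x * s := by
    have : |t * g x * s| ≤ |t| * G * (|t| * (|c| + 2 * ε)) := by
      rw [abs_mul, abs_mul]
      have := hgG x hx
      gcongr
    have h4 := (abs_le.1 this).1
    rw [← sq_abs t]
    linarith
  have h5 : t ^ 2 * R ≤ ε * |t| := by
    rw [← sq_abs t]
    nlinarith [abs_nonneg t]
  have h6 : (1 + s) * (1 + t * g x) ≤ Real.exp s * (1 + t * g x) := by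
    refine mul_le_mul_of_nonneg_right (by linarith [Real.add_one_le_exp s]) ?_
    linarith [(abs_le.1 (htg x hx)).1]
  refine le_trans ?_ h6
  change 1 + t * (g x + v) + t ^ 2 * K * transfer φ (fun y => Real.exp (τ * |f y|)) x ≤ _
  nlinarith

end Perturbation

section Pressure

lemma birkhoff_mul_add (t : ℝ) (f φ : ℝ → ℝ) (n : ℕ) (x : ℝ) :
    birkhoff (fun y => t * f y + φ y) n x = t * birkhoff f n x + birkhoff φ n x := by
  simp [birkhoff, Finset.sum_add_distrib, Finset.mul_sum]

lemma birkhoff_sub_const (ψ : ℝ → ℝ) (c : ℝ) (n : ℕ) (x : ℝ) :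
    birkhoff (fun y => ψ y - c) n x = birkhoff ψ n x - n * c := by
  simp [birkhoff]

lemma partSum_ne_zero (ψ : ℝ → ℝ) (n : ℕ) : partSum ψ n ≠ 0 := by
  intro h
  have h1 := ENNReal.tsum_eq_zero.1 h
    ⟨List.replicate n 1, by simp, fun a ha => by simp [List.eq_of_mem_replicate ha]⟩
  exact (ENNReal.ofReal_pos.2 (Real.exp_pos _)).ne' h1

lemma partSum_sub_const (ψ : ℝ → ℝ) (c : ℝ) (n : ℕ) :
    partSum (fun y => ψ y - c) n = ENNReal.ofReal (Real.exp (-(n * c))) * partSum ψ n := by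
  unfold partSum
  rw [← ENNReal.tsum_mul_left]
  refine tsum_congr fun w => ?_
  rw [birkhoff_sub_const, ← ENNReal.ofReal_mul (Real.exp_pos _).le, ← Real.exp_add]
  congr 2; ring

lemma HasPressure.partSum_toReal_pos {ψ : ℝ → ℝ} {p : ℝ} (h : HasPressure ψ p) {n : ℕ}
    (hn : 0 < n) : 0 < (partSum ψ n).toReal :=
  ENNReal.toReal_pos (partSum_ne_zero ψ n) (h.1 n hn)

lemma HasPressure.sub_const {ψ : ℝ → ℝ} {p : ℝ} (h : HasPressure ψ p) (c : ℝ) :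
    HasPressure (fun x => ψ x - c) (p - c) := by
  refine ⟨fun n hn => ?_, ?_⟩
  · rw [partSum_sub_const]
    exact ENNReal.mul_ne_top ENNReal.ofReal_ne_top (h.1 n hn)
  · refine (h.2.sub_const c).congr' ?_
    filter_upwards [eventually_gt_atTop 0] with n hn
    have hn' : (n : ℝ) ≠ 0 := by positivity
    rw [partSum_sub_const, ENNReal.toReal_mul, ENNReal.toReal_ofReal (Real.exp_pos _).le,
      Real.log_mul (Real.exp_ne_zero _) (h.partSum_toReal_pos hn).ne', Real.log_exp]
    field_simp
    ring

lemma tendsto_add_const_div_nat (b k : ℝ) :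
    Tendsto (fun n : ℕ => b + k / n) atTop (𝓝 b) := by
  simpa using (tendsto_const_div_atTop_nhds_zero_nat k).const_add b

lemma HasPressure.le_of_forall_exp_le {ψ : ℝ → ℝ} {p K b : ℝ} (h : HasPressure ψ p) (hK : 0 < K)
    (hb : ∀ n : ℕ, 0 < n → ENNReal.ofReal (Real.exp (n * b)) ≤ ENNReal.ofReal K * partSum ψ n) :
    b ≤ p := by
  refine le_of_tendsto_of_tendsto (tendsto_add_const_div_nat b (-Real.log K)) h.2 ?_
  filter_upwards [eventually_gt_atTop 0] with n hn
  have hn' : (0 : ℝ) < n := by positivity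
  have h1 := hb n hn
  rw [← ENNReal.ofReal_toReal (h.1 n hn), ← ENNReal.ofReal_mul hK.le,
    ENNReal.ofReal_le_ofReal_iff (by positivity)] at h1
  have h2 := Real.log_le_log (Real.exp_pos _) h1
  rw [Real.log_exp, Real.log_mul hK.ne' (h.partSum_toReal_pos hn).ne'] at h2
  rw [le_div_iff₀ hn']
  field_simp
  linarith

lemma HasPressure.le_of_forall_le_exp {ψ : ℝ → ℝ} {p K s : ℝ} (h : HasPressure ψ p) (hK : 0 < K)
    (hs : ∀ n : ℕ, 0 < n → partSum ψ n ≤ ENNReal.ofReal (K * Real.exp (n * s))) :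
    p ≤ s := by
  refine le_of_tendsto_of_tendsto h.2 (tendsto_add_const_div_nat s (Real.log K)) ?_
  filter_upwards [eventually_gt_atTop 0] with n hn
  have hn' : (0 : ℝ) < n := by positivity
  have h1 := ENNReal.toReal_le_of_le_ofReal (by positivity) (hs n hn)
  have h2 := Real.log_le_log (h.partSum_toReal_pos hn) h1
  rw [Real.log_mul hK.ne' (Real.exp_ne_zero _), Real.log_exp] at h2
  rw [div_le_iff₀ hn']
  field_simp
  linarith

lemma HasPressure.le_of_subeigenfunction {ψ h : ℝ → ℝ} {p C θ s : ℝ} (hp : HasPressure ψ p)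
    (hψ : WordHolder C θ ψ) (hC : 0 ≤ C) (hθ : θ ∈ Set.Ioo (0 : ℝ) 1) {x₀ : ℝ}
    (hx₀ : x₀ ∈ gaussSet) (hh : ∀ x ∈ gaussSet, 1 / 2 ≤ h x ∧ h x ≤ 2)
    (hstep : ∀ x ∈ gaussSet, ∑' a : ℕ+, ENNReal.ofReal
      (Real.exp (ψ (invBranch1 a x)) * h (invBranch1 a x)) ≤ ENNReal.ofReal (Real.exp s * h x)) :
    p ≤ s := by
  refine hp.le_of_forall_le_exp (K := Real.exp (C / (1 - θ)) * 4) (by positivity) fun n hn => ?_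
  have h1 : wordSum ψ n x₀ ≤ ENNReal.ofReal (4 * Real.exp (n * s)) := by
    calc wordSum ψ n x₀ ≤ ENNReal.ofReal 2 * ∑' w : Word n,
          ENNReal.ofReal (Real.exp (birkhoff ψ n (invBranch w.1 x₀)) * h (invBranch w.1 x₀)) := by
          rw [← ENNReal.tsum_mul_left]
          refine ENNReal.tsum_le_tsum fun w => ?_
          rw [← ENNReal.ofReal_mul (by norm_num)]
          refine ENNReal.ofReal_le_ofReal ?_
          have := (hh _ (invBranch_mem w.2.2 hx₀)).1
          nlinarith [Real.exp_pos (birkhoff ψ n (invBranch w.1 x₀))]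
      _ ≤ ENNReal.ofReal 2 * ENNReal.ofReal (Real.exp s ^ n * h x₀) := by
          gcongr
          exact tsum_word_exp_mul_le (Real.exp_pos s).le hstep hx₀ n
      _ ≤ _ := by
          rw [← ENNReal.ofReal_mul (by norm_num), ← Real.exp_nat_mul]
          refine ENNReal.ofReal_le_ofReal ?_
          nlinarith [(hh x₀ hx₀).2, Real.exp_pos (n * s)]
  refine (hψ.partSum_le hC hθ hn hx₀).trans ((mul_le_mul_right h1 _).trans (le_of_eq ?_))
  rw [← ENNReal.ofReal_mul (Real.exp_pos _).le, mul_assoc]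

end Pressure

section Integrals

variable {φ f : ℝ → ℝ} {μ : Measure ℝ} {C θ : ℝ}

lemma IsGibbs.lintegral_exp_birkhoff_le [IsFiniteMeasure μ] (hG : IsGibbs φ μ)
    (hμ : ∀ᵐ x ∂μ, x ∈ gaussSet) (hφ : WordHolder C θ φ) (hf : WordHolder C θ f) (hC : 0 ≤ C)
    (hθ : θ ∈ Set.Ioo (0 : ℝ) 1) {x₀ : ℝ} (hx₀ : x₀ ∈ gaussSet) (t : ℝ) :
    ∃ K > (0 : ℝ), ∀ n : ℕ, 0 < n → ∫⁻ x, ENNReal.ofReal (Real.exp (t * birkhoff f n x)) ∂μ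
      ≤ ENNReal.ofReal K * partSum (fun x => t * f x + φ x) n := by
  obtain ⟨D, hD, hG⟩ := hG
  refine ⟨Real.exp (|t| * (C / (1 - θ))) * D * Real.exp ((|t| + 1) * C / (1 - θ)),
    by positivity, fun n hn => ?_⟩
  have hcover : gaussSet ⊆ ⋃ w : Word n, _root_.cylinder w.1 := fun x hx =>
    mem_iUnion.2 ⟨⟨cfDigits n x, length_cfDigits n x, cfDigits_pos n hx⟩,
      mem_cylinder_cfDigits n hx⟩
  have hcyl : ∀ w : Word n,
      ∫⁻ x in _root_.cylinder w.1, ENNReal.ofReal (Real.exp (t * birkhoff f n x)) ∂μ ≤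
        ENNReal.ofReal (Real.exp (|t| * (C / (1 - θ))) * D) *
          ENNReal.ofReal (Real.exp (birkhoff (fun x => t * f x + φ x) n (invBranch w.1 x₀))) := by
    intro w
    have hne : w.1 ≠ [] := List.length_pos_iff.1 (w.2.1.symm ▸ hn)
    have hmeas : μ (_root_.cylinder w.1) ≤
        ENNReal.ofReal (D * Real.exp (birkhoff φ n (invBranch w.1 x₀))) := by
      have := (hG w.1 hne w.2.2 x₀ hx₀).2
      rw [w.2.1] at this
      exact (ENNReal.le_ofReal_iff_toReal_le (measure_ne_top μ _) (by positivity)).2 this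
    calc _ ≤ ∫⁻ _ in _root_.cylinder w.1, ENNReal.ofReal (Real.exp (|t| * (C / (1 - θ)))) *
          ENNReal.ofReal (Real.exp (t * birkhoff f n (invBranch w.1 x₀))) ∂μ := by
          refine setLIntegral_mono' (measurableSet_cylinder w.1) fun x hx => ?_
          obtain ⟨y, hy, rfl⟩ := exists_invBranch_of_mem_cylinder hx
          refine ofReal_exp_le_mul ?_
          have := hf.birkhoff_distortion hC hθ w.2.2 hy hx₀
          rw [w.2.1] at this
          rw [← mul_sub, abs_mul]
          gcongr
      _ ≤ ENNReal.ofReal (Real.exp (|t| * (C / (1 - θ)))) *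
          ENNReal.ofReal (Real.exp (t * birkhoff f n (invBranch w.1 x₀))) *
            ENNReal.ofReal (D * Real.exp (birkhoff φ n (invBranch w.1 x₀))) := by
          rw [setLIntegral_const]
          gcongr
      _ = _ := by
          rw [← ENNReal.ofReal_mul (by positivity), ← ENNReal.ofReal_mul (by positivity),
            ← ENNReal.ofReal_mul (by positivity), birkhoff_mul_add, Real.exp_add]
          congr 1; ring
  calc _ = ∫⁻ x in gaussSet, ENNReal.ofReal (Real.exp (t * birkhoff f n x)) ∂μ := by
        rw [Measure.restrict_eq_self_of_ae_mem hμ]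
    _ ≤ ∑' w : Word n,
        ∫⁻ x in _root_.cylinder w.1, ENNReal.ofReal (Real.exp (t * birkhoff f n x)) ∂μ :=
        (lintegral_mono_set hcover).trans (lintegral_iUnion_le _ _)
    _ ≤ ENNReal.ofReal (Real.exp (|t| * (C / (1 - θ))) * D) *
        wordSum (fun x => t * f x + φ x) n x₀ := by
        rw [wordSum, ← ENNReal.tsum_mul_left]
        exact ENNReal.tsum_le_tsum hcyl
    _ ≤ _ := by
        rw [ENNReal.ofReal_mul (by positivity : 0 ≤ Real.exp (|t| * (C / (1 - θ))) * D), mul_assoc]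
        gcongr
        exact (hf.mul_add hφ t).wordSum_le (by positivity) hθ hn hx₀

lemma WordHolder.aemeasurable (hf : WordHolder C θ f) (hθ : θ ∈ Set.Ioo (0 : ℝ) 1)
    (hμ : ∀ᵐ x ∂μ, x ∈ gaussSet) : AEMeasurable f μ := by
  rcases gaussSet.eq_empty_or_nonempty with h | ⟨x₀, hx₀⟩
  · have : μ = 0 := by simpa [h] using hμ
    rw [this]
    exact aemeasurable_zero_measure
  refine aemeasurable_of_tendsto_metrizable_ae atTop
    (f := fun (n : ℕ) x => f (invBranch (cfDigits n x) x₀))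
    (fun n => (measurable_comp_cfDigits (fun l => f (invBranch l x₀)) n).aemeasurable) ?_
  filter_upwards [hμ] with x hx
  have hlim : Tendsto (fun n : ℕ => C * θ ^ n) atTop (𝓝 0) := by
    simpa using (tendsto_pow_atTop_nhds_zero_of_lt_one hθ.1.le hθ.2).const_mul C
  refine tendsto_iff_norm_sub_tendsto_zero.2 (squeeze_zero' (.of_forall fun _ => norm_nonneg _)
    ?_ hlim)
  filter_upwards [eventually_gt_atTop 0] with n hn
  obtain ⟨y, hy, hxy⟩ := exists_invBranch_of_mem_cylinder (mem_cylinder_cfDigits n hx)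
  have := hf (cfDigits n x) (List.length_pos_iff.1 (by rwa [length_cfDigits]))
    (cfDigits_pos n hx) x₀ hx₀ y hy
  rwa [length_cfDigits, ← hxy] at this

lemma integrable_of_lintegral_exp_ne_top {τ : ℝ} (hτ : 0 < τ) (hf : AEMeasurable f μ)
    (h1 : ∫⁻ x, ENNReal.ofReal (Real.exp (τ * f x)) ∂μ ≠ ⊤)
    (h2 : ∫⁻ x, ENNReal.ofReal (Real.exp (-τ * f x)) ∂μ ≠ ⊤) : Integrable f μ := by
  have key : ∀ s : ℝ, ∫⁻ x, ENNReal.ofReal (Real.exp (s * f x)) ∂μ ≠ ⊤ →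
      Integrable (fun x => Real.exp (s * f x)) μ := fun s hs =>
    ⟨(Real.measurable_exp.comp_aemeasurable (hf.const_mul s)).aestronglyMeasurable,
      (hasFiniteIntegral_iff_ofReal (.of_forall fun x => (Real.exp_pos _).le)).2 hs.lt_top⟩
  refine Integrable.mono' (((key τ h1).add (key (-τ) h2)).div_const τ)
    hf.aestronglyMeasurable (.of_forall fun x => ?_)
  simp only [Pi.add_apply]
  rw [Real.norm_eq_abs, le_div_iff₀ hτ]
  rcases abs_cases (f x) with ⟨h, -⟩ | ⟨h, -⟩ <;> rw [h]
  · linarith [Real.add_one_le_exp (τ * f x), Real.exp_pos (-τ * f x)]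
  · linarith [Real.add_one_le_exp (-τ * f x), Real.exp_pos (τ * f x)]

lemma ofReal_exp_integral_le [IsProbabilityMeasure μ] {g : ℝ → ℝ} (hg : Integrable g μ) :
    ENNReal.ofReal (Real.exp (∫ x, g x ∂μ)) ≤ ∫⁻ x, ENNReal.ofReal (Real.exp (g x)) ∂μ := by
  by_cases h : ∫⁻ x, ENNReal.ofReal (Real.exp (g x)) ∂μ = ⊤
  · simp [h]
  have hexp : Integrable (fun x => Real.exp (g x)) μ :=
    ⟨(Real.measurable_exp.comp_aemeasurable hg.aemeasurable).aestronglyMeasurable,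
      (hasFiniteIntegral_iff_ofReal (.of_forall fun x => (Real.exp_pos _).le)).2
        (lt_top_iff_ne_top.2 h)⟩
  rw [← ofReal_integral_eq_lintegral_ofReal hexp (.of_forall fun x => (Real.exp_pos _).le)]
  exact ENNReal.ofReal_le_ofReal (convexOn_exp.map_integral_le Real.continuous_exp.continuousOn
    isClosed_univ (by simp) hg hexp)

lemma GaussInvariant.measurePreserving (h : GaussInvariant μ) : MeasurePreserving gaussMap μ μ :=
  ⟨measurable_gaussMap, Measure.ext fun s hs => by
    rw [Measure.map_apply measurable_gaussMap hs, h s hs]⟩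

lemma GaussInvariant.integrable_birkhoff (h : GaussInvariant μ) (hf : Integrable f μ) (n : ℕ) :
    Integrable (birkhoff f n) μ :=
  integrable_finsetSum _ fun k _ => (h.measurePreserving.iterate k).integrable_comp_of_integrable hf

lemma GaussInvariant.integral_birkhoff (h : GaussInvariant μ) (hf : Integrable f μ) (n : ℕ) :
    ∫ x, birkhoff f n x ∂μ = n * ∫ x, f x ∂μ := by
  have hk : ∀ k, ∫ x, f (gaussMap^[k] x) ∂μ = ∫ x, f x ∂μ := fun k => by
    have hm := h.measurePreserving.iterate k
    rw [← integral_map hm.measurable.aemeasurable (by rw [hm.map_eq]; exact hf.1), hm.map_eq]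
  refine (integral_finsetSum (Finset.range n) (f := fun k x => f (gaussMap^[k] x)) fun k _ =>
    (h.measurePreserving.iterate k).integrable_comp_of_integrable hf).trans ?_
  simp [hk]

lemma IsGibbs.mul_integral_le_pressure [IsProbabilityMeasure μ] (hG : IsGibbs φ μ)
    (hinv : GaussInvariant μ) (hμ : ∀ᵐ x ∂μ, x ∈ gaussSet) (hφ : WordHolder C θ φ)
    (hf : WordHolder C θ f) (hC : 0 ≤ C) (hθ : θ ∈ Set.Ioo (0 : ℝ) 1) {x₀ : ℝ}
    (hx₀ : x₀ ∈ gaussSet) (hint : Integrable f μ) {t p : ℝ}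
    (hp : HasPressure (fun x => t * f x + φ x) p) : t * ∫ x, f x ∂μ ≤ p := by
  obtain ⟨K, hK, hle⟩ := hG.lintegral_exp_birkhoff_le hμ hφ hf hC hθ hx₀ t
  refine hp.le_of_forall_exp_le hK fun n hn => le_trans ?_ (hle n hn)
  have := ofReal_exp_integral_le ((hinv.integrable_birkhoff hint n).const_mul t)
  rwa [integral_const_mul, hinv.integral_birkhoff hint, mul_left_comm] at this

end Integrals

section Moments

/-- Finiteness of the partition functions of `±τ f + φ` yields uniform exponential moments of `f`
under the transfer operator of `φ`. -/
lemma exists_transfer_exp_abs_le {φ f : ℝ → ℝ} {C θ τ : ℝ} (hφ : WordHolder C θ φ)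
    (hf : WordHolder C θ f) (hC : 0 ≤ C) (hθ : θ ∈ Set.Ioo (0 : ℝ) 1)
    (h1 : partSum (fun x => τ * f x + φ x) 1 ≠ ⊤)
    (h2 : partSum (fun x => -τ * f x + φ x) 1 ≠ ⊤) :
    ∃ M : ℝ, ∀ x ∈ gaussSet, (Summable fun a : ℕ+ =>
      Real.exp (φ (invBranch1 a x)) * Real.exp (τ * |f (invBranch1 a x)|)) ∧
      transfer φ (fun y => Real.exp (τ * |f y|)) x ≤ M := by
  set B₁ := ENNReal.ofReal (Real.exp ((|τ| + 1) * C / (1 - θ))) *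
    partSum (fun x => τ * f x + φ x) 1 with hB₁
  set B₂ := ENNReal.ofReal (Real.exp ((|-τ| + 1) * C / (1 - θ))) *
    partSum (fun x => -τ * f x + φ x) 1 with hB₂
  have hB : B₁ + B₂ ≠ ⊤ := ENNReal.add_ne_top.2
    ⟨ENNReal.mul_ne_top ENNReal.ofReal_ne_top h1, ENNReal.mul_ne_top ENNReal.ofReal_ne_top h2⟩
  refine ⟨(B₁ + B₂).toReal, fun x hx => ?_⟩
  have hle : ∑' a : ℕ+, ENNReal.ofReal
      (Real.exp (φ (invBranch1 a x)) * Real.exp (τ * |f (invBranch1 a x)|)) ≤ B₁ + B₂ := by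
    refine le_trans ?_ (add_le_add ((hf.mul_add hφ τ).wordSum_le (by positivity) hθ one_pos hx)
      ((hf.mul_add hφ (-τ)).wordSum_le (by positivity) hθ one_pos hx))
    rw [wordSum_one, wordSum_one, ← ENNReal.tsum_add]
    refine ENNReal.tsum_le_tsum fun a => ?_
    rw [← Real.exp_add, ← ENNReal.ofReal_add (Real.exp_pos _).le (Real.exp_pos _).le]
    refine ENNReal.ofReal_le_ofReal ?_
    rcases abs_cases (f (invBranch1 a x)) with ⟨h, -⟩ | ⟨h, -⟩ <;> rw [h]
    · rw [add_comm (φ _)]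
      exact le_add_of_nonneg_right (Real.exp_pos _).le
    · rw [add_comm (φ _), mul_neg, ← neg_mul]
      exact le_add_of_nonneg_left (Real.exp_pos _).le
  have hs : Summable fun a : ℕ+ =>
      Real.exp (φ (invBranch1 a x)) * Real.exp (τ * |f (invBranch1 a x)|) := by
    have := ENNReal.summable_toReal (ne_top_of_le_ne_top hB hle)
    refine this.congr fun a => ?_
    rw [ENNReal.toReal_ofReal (by positivity)]
  refine ⟨hs, ?_⟩
  rw [← ENNReal.ofReal_tsum_of_nonneg (fun a => by positivity) hs,
    ENNReal.ofReal_le_iff_le_toReal hB] at hle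
  exact hle

end Moments

/-- Convexity of the pressure: if `P(tf+φ) < ∞` for all
`t ∈ (-t₀,t₀)`, then for every `α ≠ ∫ f dμ_φ` there is `t ∈ (-t₀,t₀)` with
`P(t(f-α)+φ) < 0`. -/
theorem pressure_negative_of_shift
    (φ f : ℝ → ℝ) (μ : MeasureTheory.Measure ℝ) [MeasureTheory.IsProbabilityMeasure μ]
    (hμX : μ gaussSet = 1) (hinv : GaussInvariant μ)
    (hφH : LocHolder φ) (hφ0 : ∀ x ∈ gaussSet, φ x ≤ 0) (hP : HasPressure φ 0)
    (hL : TransferNormalized φ) (hGibbs : IsGibbs φ μ) (hfH : LocHolder f)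
    (t₀ : ℝ) (ht₀ : 0 < t₀)
    (hfin : ∀ t ∈ Set.Ioo (-t₀) t₀, PressureFinite fun x => t * f x + φ x) :
    ∀ α : ℝ, α ≠ ∫ y, f y ∂μ →
      ∃ t ∈ Set.Ioo (-t₀) t₀, ∃ p < (0:ℝ),
        HasPressure (fun x => t * (f x - α) + φ x) p := by
  intro α hα
  set m := ∫ y, f y ∂μ with hm
  have hμ : ∀ᵐ x ∂μ, x ∈ gaussSet := (prob_compl_eq_zero_iff measurableSet_gaussSet).2 hμX
  obtain ⟨x₀, hx₀⟩ : gaussSet.Nonempty :=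
    nonempty_of_measure_ne_zero (μ := μ) (by rw [hμX]; exact one_ne_zero)
  obtain ⟨C, hC, θ, hθ, hφ, hf⟩ := hφH.exists_common hfH
  have hτ : 0 < t₀ / 2 := by positivity
  have hfinite : ∀ t ∈ Set.Ioo (-t₀) t₀, partSum (fun x => t * f x + φ x) 1 ≠ ⊤ := fun t ht =>
    let ⟨_, hp⟩ := hfin t ht
    hp.1 1 one_pos
  have hfin₁ := hfinite (t₀ / 2) ⟨by linarith, by linarith⟩
  have hfin₂ := hfinite (-(t₀ / 2)) ⟨by linarith, by linarith⟩
  have hexp : ∀ t : ℝ, partSum (fun x => t * f x + φ x) 1 ≠ ⊤ →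
      ∫⁻ x, ENNReal.ofReal (Real.exp (t * f x)) ∂μ ≠ ⊤ := fun t ht => by
    obtain ⟨K, -, hle⟩ := hGibbs.lintegral_exp_birkhoff_le hμ hφ hf hC.le hθ hx₀ t
    have := hle 1 one_pos
    simp only [birkhoff, Finset.range_one, Finset.sum_singleton, Function.iterate_zero, id] at this
    exact ne_top_of_le_ne_top (ENNReal.mul_ne_top ENNReal.ofReal_ne_top ht) this
  have hint : Integrable f μ := integrable_of_lintegral_exp_ne_top hτ (hf.aemeasurable hθ hμ)
    (hexp _ hfin₁) (hexp _ hfin₂)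
  obtain ⟨M, hM⟩ := exists_transfer_exp_abs_le hφ hf hC.le hθ hfin₁ hfin₂
  have hε : 0 < |m - α| / 5 := by
    have := abs_pos.2 (sub_ne_zero.2 hα.symm)
    positivity
  set ε := |m - α| / 5 with hεdef
  obtain ⟨c, t₁, ht₁, hsub⟩ := exists_perturbed_subeigenfunction hL hφ hf hC.le hθ hτ ⟨x₀, hx₀⟩
    (fun x hx => (hM x hx).1) (fun x hx => (hM x hx).2) hε
  have hbounds : ∀ t : ℝ, |t| ≤ t₁ → ∀ p, HasPressure (fun x => t * f x + φ x) p →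
      t * m ≤ p ∧ p ≤ t * c + 2 * ε * |t| := fun t ht p hp => by
    obtain ⟨h, hh, hstep⟩ := hsub t ht
    exact ⟨hGibbs.mul_integral_le_pressure hinv hμ hφ hf hC.le hθ hx₀ hint hp,
      hp.le_of_subeigenfunction (hf.mul_add hφ t) (by positivity) hθ hx₀ hh hstep⟩
  set r := min t₁ (t₀ / 2) with hr
  have hr0 : 0 < r := lt_min ht₁ hτ
  have hrt₁ : r ≤ t₁ := min_le_left _ _
  have hrt₀ : r ≤ t₀ / 2 := min_le_right _ _
  obtain ⟨p₁, hp₁⟩ := hfin r ⟨by linarith, by linarith⟩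
  obtain ⟨p₂, hp₂⟩ := hfin (-r) ⟨by linarith, by linarith⟩
  have hb₁ := hbounds r (by rwa [abs_of_pos hr0]) p₁ hp₁
  have hb₂ := hbounds (-r) (by rwa [abs_neg, abs_of_pos hr0]) p₂ hp₂
  rw [abs_of_pos hr0] at hb₁
  rw [abs_neg, abs_of_pos hr0] at hb₂
  have hshift : ∀ t p, HasPressure (fun x => t * f x + φ x) p →
      HasPressure (fun x => t * (f x - α) + φ x) (p - t * α) := fun t p hp => by
    convert hp.sub_const (t * α) using 2
    ring
  rcases hα.lt_or_gt with h | h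
  · refine ⟨-r, ⟨by linarith, by linarith⟩, _, ?_, hshift _ _ hp₂⟩
    rw [abs_of_pos (by linarith)] at hεdef
    nlinarith
  · refine ⟨r, ⟨by linarith, by linarith⟩, _, ?_, hshift _ _ hp₁⟩
    rw [abs_of_neg (by linarith)] at hεdef
    nlinarith
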